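/- arXiv:1303.3721 — 8 statements merged into one kernel-verified Lean document; each statement's English description precedes it below -/
import Mathlib

section
/- Let K be a nonempty compact convex subset of ℝⁿ, p₀ ∈ ∂K, and let u ∈ ℝⁿ with u ∉ T_K(p₀) (in particular u ≠ 0). For ε > 0 set p_ε = p₀ + εu. Then p_ε ∉ K, and the normal cone of the cap body K^{p_ε} at p_ε satisfies {x : ⟨x, u⟩ ≥ 0} ⊇ N_{K^{p_ε}}(p_ε) ⊇ N_K(p₀) ∩ {x : ⟨x, u⟩ ≥ 0}. -/
open Set Metric MeasureTheory
open scoped RealInnerProductSpace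

noncomputable section

/-- Support function of a set. -/
def suppFn {n : ℕ} (C : Set (EuclideanSpace ℝ (Fin n))) (x : EuclideanSpace ℝ (Fin n)) : ℝ :=
  sSup ((fun y => ⟪x, y⟫) '' C)

/-- Normal cone of a set `C` at `q`. -/
def normalCone {n : ℕ} (C : Set (EuclideanSpace ℝ (Fin n))) (q : EuclideanSpace ℝ (Fin n)) :
    Set (EuclideanSpace ℝ (Fin n)) :=
  {v | ∀ y ∈ C, ⟪v, y - q⟫ ≤ 0}

/-- Tangent (support) cone of `C` at `q`. -/
def supportCone {n : ℕ} (C : Set (EuclideanSpace ℝ (Fin n))) (q : EuclideanSpace ℝ (Fin n)) :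
    Set (EuclideanSpace ℝ (Fin n)) :=
  closure {v | ∃ s : ℝ, 0 ≤ s ∧ ∃ y ∈ C, v = s • (y - q)}

/-- Cap body: convex hull of `K ∪ {p}`. -/
def capBody {n : ℕ} (K : Set (EuclideanSpace ℝ (Fin n))) (p : EuclideanSpace ℝ (Fin n)) :
    Set (EuclideanSpace ℝ (Fin n)) :=
  convexHull ℝ (K ∪ {p})

/-- Spherical Lebesgue (surface) measure on `ℝⁿ`: the `(n-1)`-dimensional Hausdorff measure. -/
def sphereMeasure (n : ℕ) : Measure (EuclideanSpace ℝ (Fin n)) := μH[(n : ℝ) - 1]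

/-- Total surface measure of the unit sphere in `ℝⁿ`. -/
def sphereArea (n : ℕ) : ℝ :=
  (sphereMeasure n (sphere (0 : EuclideanSpace ℝ (Fin n)) 1)).toReal

/-- Mean width of a set `C ⊆ ℝⁿ`. -/
def meanWidth {n : ℕ} (C : Set (EuclideanSpace ℝ (Fin n))) : ℝ :=
  (2 / sphereArea n) * ∫ θ in sphere (0 : EuclideanSpace ℝ (Fin n)) 1, suppFn C θ ∂(sphereMeasure n)

/-- Self expanding curve on `[a,b]`. -/
def SelfExpanding {n : ℕ} (a b : ℝ) (x : ℝ → EuclideanSpace ℝ (Fin n)) : Prop :=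
  ContinuousOn x (Icc a b) ∧
  ∀ t₁ t₂ t₃, a ≤ t₁ → t₁ ≤ t₂ → t₂ ≤ t₃ → t₃ ≤ b → dist (x t₂) (x t₁) ≤ dist (x t₃) (x t₁)

/-- Quasi convex family on `[a,b]`. -/
def QuasiConvexFamily {n : ℕ} (a b : ℝ) (Ω : ℝ → Set (EuclideanSpace ℝ (Fin n))) : Prop :=
  (∀ t ∈ Icc a b, (Ω t).Nonempty ∧ IsCompact (Ω t) ∧ Convex ℝ (Ω t)) ∧
  (∀ s t, a ≤ s → s < t → t ≤ b → Ω s ⊂ Ω t) ∧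
  (∀ s ∈ Ico a b, ⋂ t ∈ Ioc s b, Ω t = Ω s)

/-- Connectedness of a quasi convex family. -/
def ConnectedFamily {n : ℕ} (a b : ℝ) (Ω : ℝ → Set (EuclideanSpace ℝ (Fin n))) : Prop :=
  ∀ x ∈ Ω b \ intrinsicInterior ℝ (Ω a), ∃ t ∈ Icc a b, x ∈ intrinsicFrontier ℝ (Ω t)


/-- inclusions for the normal cone of a cap body. -/
theorem normalCone_capBody_inclusions {n : ℕ} (K : Set (EuclideanSpace ℝ (Fin n)))
    (hne : K.Nonempty) (hcomp : IsCompact K) (hconv : Convex ℝ K)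
    (p₀ : EuclideanSpace ℝ (Fin n)) (hp₀ : p₀ ∈ frontier K)
    (u : EuclideanSpace ℝ (Fin n)) (hu : u ∉ supportCone K p₀) (hu0 : u ≠ 0)
    (ε : ℝ) (hε : 0 < ε) :
    p₀ + ε • u ∉ K ∧
    normalCone (capBody K (p₀ + ε • u)) (p₀ + ε • u) ⊆ {x | 0 ≤ ⟪x, u⟫} ∧
    normalCone K p₀ ∩ {x | 0 ≤ ⟪x, u⟫} ⊆
      normalCone (capBody K (p₀ + ε • u)) (p₀ + ε • u) := by
  have hpK : p₀ ∈ K := hcomp.isClosed.frontier_subset hp₀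
  refine ⟨?_, ?_, ?_⟩
  · intro h
    apply hu
    refine subset_closure ⟨ε⁻¹, (inv_pos.mpr hε).le, _, h, ?_⟩
    rw [add_sub_cancel_left, smul_smul, inv_mul_cancel₀ hε.ne', one_smul]
  · intro x hx
    have h := hx p₀ (subset_convexHull ℝ _ (Or.inl hpK))
    have e : p₀ - (p₀ + ε • u) = -(ε • u) := by abel
    rw [e, inner_neg_right, inner_smul_right] at h
    have h2 : 0 ≤ ε * ⟪x, u⟫ := by linarith
    exact nonneg_of_mul_nonneg_right h2 hε
  · rintro x ⟨hx, hxu⟩ y hy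
    have hxu' : 0 ≤ ⟪x, u⟫ := hxu
    have hsub : convexHull ℝ (K ∪ {p₀ + ε • u}) ⊆ {z | ⟪x, z⟫ ≤ ⟪x, p₀ + ε • u⟫} := by
      apply convexHull_min
      · rintro z (hz | hz)
        · have h := hx z hz
          rw [inner_sub_right] at h
          have h3 := mul_nonneg hε.le hxu'
          show ⟪x, z⟫ ≤ ⟪x, p₀ + ε • u⟫
          rw [inner_add_right, inner_smul_right]
          linarith
        · rw [mem_singleton_iff] at hz
          subst hz
          exact le_refl (⟪x, p₀ + ε • u⟫ : ℝ)
      · exact convex_halfSpace_le (innerSL ℝ x).toLinearMap.isLinear _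
    have h : ⟪x, y⟫ ≤ ⟪x, p₀ + ε • u⟫ := hsub hy
    rw [inner_sub_right]
    linarith

end
end

section
/- Let K be a nonempty compact convex subset of ℝⁿ, p₀ ∈ ∂K, and let u ∉ T_K(p₀), u ≠ 0; for ε > 0 set p_ε = p₀ + εu, so p_ε ∉ K. Then the normal cones N_{K^{p_ε}}(p_ε) converge to N_K(p₀) ∩ {x : ⟨x, u⟩ ≥ 0} as ε → 0⁺ in the following sense: (a) for every sequence ε_k → 0⁺ and every convergent sequence v_k → v with v_k ∈ N_{K^{p_{ε_k}}}(p_{ε_k}), the limit v belongs to N_K(p₀) ∩ {x : ⟨x, u⟩ ≥ 0}; (b) every v ∈ N_K(p₀) ∩ {x : ⟨x, u⟩ ≥ 0} belongs to N_{K^{p_ε}}(p_ε) for every ε > 0. -/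
open Set Metric MeasureTheory
open scoped RealInnerProductSpace

noncomputable section

/-- convergence of normal cones of cap bodies. -/
theorem normalCone_capBody_limit {n : ℕ} (K : Set (EuclideanSpace ℝ (Fin n)))
    (hne : K.Nonempty) (hcomp : IsCompact K) (hconv : Convex ℝ K)
    (p₀ : EuclideanSpace ℝ (Fin n)) (hp₀ : p₀ ∈ frontier K)
    (u : EuclideanSpace ℝ (Fin n)) (hu : u ∉ supportCone K p₀) (hu0 : u ≠ 0) :
    (∀ ε : ℝ, 0 < ε → p₀ + ε • u ∉ K) ∧
    (∀ ε : ℕ → ℝ, (∀ k, 0 < ε k) → Filter.Tendsto ε Filter.atTop (nhds 0) →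
      ∀ (v : ℕ → EuclideanSpace ℝ (Fin n)) (v₀ : EuclideanSpace ℝ (Fin n)),
        (∀ k, v k ∈ normalCone (capBody K (p₀ + ε k • u)) (p₀ + ε k • u)) →
        Filter.Tendsto v Filter.atTop (nhds v₀) →
        v₀ ∈ normalCone K p₀ ∩ {x | 0 ≤ ⟪x, u⟫}) ∧
    (∀ v₀ ∈ normalCone K p₀ ∩ {x | 0 ≤ ⟪x, u⟫}, ∀ ε : ℝ, 0 < ε →
      v₀ ∈ normalCone (capBody K (p₀ + ε • u)) (p₀ + ε • u)) := by
  have hpK : p₀ ∈ K := hcomp.isClosed.frontier_subset hp₀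
  refine ⟨?_, ?_, ?_⟩
  · intro ε hε hmem
    apply hu
    refine subset_closure ⟨ε⁻¹, (inv_pos.2 hε).le, p₀ + ε • u, hmem, ?_⟩
    rw [add_sub_cancel_left, smul_smul, inv_mul_cancel₀ hε.ne', one_smul]
  · intro ε hε hlim v v₀ hv hvlim
    have hsub : ∀ k, K ⊆ capBody K (p₀ + ε k • u) := fun k =>
      subset_union_left.trans (subset_convexHull ℝ _)
    refine ⟨?_, ?_⟩
    · intro y hy
      have hp : Filter.Tendsto (fun k => y - (p₀ + ε k • u)) Filter.atTop
          (nhds (y - (p₀ + (0 : ℝ) • u))) :=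
        tendsto_const_nhds.sub (tendsto_const_nhds.add (hlim.smul_const u))
      rw [zero_smul, add_zero] at hp
      exact le_of_tendsto (hvlim.inner hp)
        (Filter.Eventually.of_forall fun k => hv k y (hsub k hy))
    · refine ge_of_tendsto (Filter.Tendsto.inner (𝕜 := ℝ) hvlim (tendsto_const_nhds (x := u)))
        (Filter.Eventually.of_forall fun k => ?_)
      have h := hv k p₀ (hsub k hpK)
      rw [sub_add_cancel_left, inner_neg_right, real_inner_smul_right] at h
      exact nonneg_of_mul_nonneg_right (by linarith) (hε k)
  · rintro v₀ ⟨hv, hvu⟩ ε hε y hy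
    have hvu' : 0 ≤ ⟪v₀, u⟫ := hvu
    have hsub : capBody K (p₀ + ε • u) ⊆ {y | ⟪v₀, y⟫ ≤ ⟪v₀, p₀ + ε • u⟫} := by
      refine convexHull_min ?_ ?_
      · rintro z (hz | hz)
        · have h := hv z hz
          have h2 := mul_nonneg hε.le hvu'
          rw [inner_sub_right] at h
          simp only [mem_ofPred_eq, inner_add_right, real_inner_smul_right]
          linarith
        · rw [mem_singleton_iff.1 hz]
          simp only [mem_ofPred_eq, le_refl]
      · exact convex_halfSpace_le (innerₛₗ ℝ v₀).isLinear _
    have h : ⟪v₀, y⟫ ≤ ⟪v₀, p₀ + ε • u⟫ := hsub hy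
    rw [inner_sub_right]
    linarith

end
end

section
/- Let n ≥ 2, K a nonempty compact convex subset of ℝⁿ, p₀ ∈ ∂K, u ∉ T_K(p₀) with u ≠ 0, and for ε > 0 set p_ε = p₀ + εu. Write N(p₀) = N_K(p₀), N(p_ε) = N_{K^{p_ε}}(p_ε), and for a cone N let N̂ = N ∩ S^{n−1}. Then (ω_n/2)(w(K^{p_ε}) − w(K)) = ε ∫_{N̂(p₀) ∩ {u}*} ⟨θ, u⟩ dσ(θ) + R(ε), where R(ε) = ∫_{N̂(p_ε) ∖ (N̂(p₀) ∩ {u}*)} (h_{K^{p_ε}}(θ) − h_K(θ)) dσ(θ), and R(ε) ≥ 0 with R(ε)/ε → 0 as ε → 0⁺. -/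
open Set Metric MeasureTheory
open scoped RealInnerProductSpace

noncomputable section

lemma lipschitz_normalize_aux {E : Type*} [NormedAddCommGroup E] [NormedSpace ℝ E] (x y : E)
    (hx : 1 ≤ ‖x‖) (hy : 1 ≤ ‖y‖) : ‖‖x‖⁻¹ • x - ‖y‖⁻¹ • y‖ ≤ 2 * ‖x - y‖ := by
  have hx0 : 0 < ‖x‖ := by linarith
  have hy0 : 0 < ‖y‖ := by linarith
  have h1 : ‖x‖⁻¹ • x - ‖y‖⁻¹ • y = ‖x‖⁻¹ • (x - y) + (‖x‖⁻¹ - ‖y‖⁻¹) • y := by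
    rw [smul_sub, sub_smul]; abel
  have hinv : ‖x‖⁻¹ ≤ 1 := inv_le_one_of_one_le₀ hx
  have h2 : ‖(‖x‖⁻¹ - ‖y‖⁻¹) • y‖ = ‖x‖⁻¹ * |‖y‖ - ‖x‖| := by
    have : ‖x‖⁻¹ - ‖y‖⁻¹ = ‖x‖⁻¹ * ‖y‖⁻¹ * (‖y‖ - ‖x‖) := by field_simp
    rw [norm_smul, this, Real.norm_eq_abs, abs_mul, abs_of_pos (by positivity)]
    field_simp
  have h3 : |‖y‖ - ‖x‖| ≤ ‖x - y‖ := by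
    rw [norm_sub_rev]; exact abs_norm_sub_norm_le y x
  rw [h1]
  refine (norm_add_le _ _).trans ?_
  rw [h2, norm_smul, norm_inv, norm_norm]
  have := norm_nonneg (x - y)
  have := abs_nonneg (‖y‖ - ‖x‖)
  have hi : 0 < ‖x‖⁻¹ := by positivity
  nlinarith

def faceMap (m : ℕ) (i : Fin (m + 1)) (s : ℝ) (y : Fin m → ℝ) : EuclideanSpace ℝ (Fin (m + 1)) :=
  WithLp.toLp 2 (Fin.insertNth (α := fun _ => ℝ) i s y)

lemma one_le_norm_faceMap (m : ℕ) (i : Fin (m + 1)) (s : ℝ) (hs : |s| = 1) (y : Fin m → ℝ) :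
    1 ≤ ‖faceMap m i s y‖ := by
  have := PiLp.norm_apply_le (faceMap m i s y) i
  simpa [faceMap, hs] using this

lemma faceMap_lipschitz (m : ℕ) (i : Fin (m + 1)) (s : ℝ) :
    ∃ C : NNReal, LipschitzWith C (faceMap m i s) := by
  refine ⟨_, (PiLp.lipschitzWith_toLp 2 (fun _ : Fin (m + 1) => ℝ)).comp
    (LipschitzWith.of_dist_le_mul (K := 1) fun x y => ?_)⟩
  rw [NNReal.coe_one, one_mul, dist_pi_le_iff dist_nonneg]
  intro j
  refine Fin.succAboveCases i ?_ ?_ j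
  · simp
  · intro k
    simpa using dist_le_pi_dist x y k

lemma face_finite (m : ℕ) (i : Fin (m + 1)) (s : ℝ) (hs : |s| = 1) :
    μH[(m : ℝ)] ((fun y => ‖faceMap m i s y‖⁻¹ • faceMap m i s y) '' (Icc (fun _ => -1) (fun _ => 1)))
      < ⊤ := by
  obtain ⟨C, hC⟩ := faceMap_lipschitz m i s
  have hL : LipschitzWith (2 * C) (fun y => ‖faceMap m i s y‖⁻¹ • faceMap m i s y) := by
    refine LipschitzWith.of_dist_le_mul fun x y => ?_
    rw [dist_eq_norm]
    refine (lipschitz_normalize_aux _ _ (one_le_norm_faceMap m i s hs x)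
      (one_le_norm_faceMap m i s hs y)).trans ?_
    have := hC.dist_le_mul x y
    rw [dist_eq_norm] at this
    push_cast
    linarith
  refine (hL.hausdorffMeasure_image_le (Nat.cast_nonneg m) _).trans_lt ?_
  refine ENNReal.mul_lt_top (ENNReal.rpow_lt_top_of_nonneg (Nat.cast_nonneg m)
    ENNReal.coe_ne_top) ?_
  have h := hausdorffMeasure_pi_real (ι := Fin m)
  rw [Fintype.card_fin] at h
  rw [h]
  exact isCompact_Icc.measure_lt_top

lemma sphereMeasure_sphere_lt_top {n : ℕ} (hn : 2 ≤ n) :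
    sphereMeasure n (sphere (0 : EuclideanSpace ℝ (Fin n)) 1) < ⊤ := by
  obtain ⟨m, rfl⟩ : ∃ m, n = m + 1 := ⟨n - 1, by omega⟩
  unfold sphereMeasure
  have e : ((m + 1 : ℕ) : ℝ) - 1 = m := by push_cast; ring
  rw [e]
  let B : Set (Fin m → ℝ) := Icc (fun _ => -1) (fun _ => 1)
  let g : Fin (m + 1) → ℝ → (Fin m → ℝ) → EuclideanSpace ℝ (Fin (m + 1)) :=
    fun i s y => ‖faceMap m i s y‖⁻¹ • faceMap m i s y
  have hsub : sphere (0 : EuclideanSpace ℝ (Fin (m + 1))) 1 ⊆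
      ⋃ i, (g i 1 '' B ∪ g i (-1) '' B) := by
    intro x hx
    have hx1 : ‖x‖ = 1 := by simpa using hx
    obtain ⟨i, -, hi⟩ := Finset.exists_max_image Finset.univ (fun i => |x i|) ⟨0, Finset.mem_univ _⟩
    have hpos : 0 < |x i| := by
      rw [abs_pos]
      intro h0
      have : x = 0 := by
        ext j
        have := hi j (Finset.mem_univ _)
        rw [h0] at this
        simpa using this
      rw [this] at hx1
      simp at hx1
    have key : ∀ s : ℝ, s = x i / |x i| → x ∈ g i s '' B := by
      intro s hs
      refine ⟨fun k => x (i.succAbove k) / |x i|, ?_, ?_⟩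
      · have hb : ∀ k, abs (x (i.succAbove k) / |x i|) ≤ 1 := by
          intro k
          rw [abs_div, abs_abs, div_le_one hpos]
          exact hi _ (Finset.mem_univ _)
        exact ⟨fun k => (abs_le.1 (hb k)).1, fun k => (abs_le.1 (hb k)).2⟩
      · have hf : faceMap m i s (fun k => x (i.succAbove k) / |x i|) = |x i|⁻¹ • x := by
          ext j
          refine Fin.succAboveCases i ?_ ?_ j
          · simp [faceMap, hs, div_eq_inv_mul]
          · intro k
            simp [faceMap, div_eq_inv_mul]
        simp only [g]
        rw [hf, norm_smul, hx1, smul_smul]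
        simp [hpos.ne']
    refine mem_iUnion.2 ⟨i, ?_⟩
    rcases le_or_gt 0 (x i) with h | h
    · left
      apply key
      rw [abs_of_nonneg h] at hpos ⊢
      rw [div_self hpos.ne']
    · right
      apply key
      rw [abs_of_neg h, div_neg, div_self h.ne]
  refine (measure_mono hsub).trans_lt ?_
  refine (measure_iUnion_le _).trans_lt ?_
  rw [tsum_fintype]
  refine ENNReal.sum_lt_top.2 fun i _ => ?_
  refine (measure_union_le _ _).trans_lt (ENNReal.add_lt_top.2 ⟨?_, ?_⟩)
  · exact face_finite m i 1 (by simp)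
  · exact face_finite m i (-1) (by simp)

section geom
variable {n : ℕ} {K : Set (EuclideanSpace ℝ (Fin n))}

lemma suppFn_isLUB (hne : K.Nonempty) (hcomp : IsCompact K) (x : EuclideanSpace ℝ (Fin n)) :
    IsLUB ((fun y => ⟪x, y⟫) '' K) (suppFn K x) :=
  isLUB_csSup (hne.image _) (hcomp.image (by fun_prop)).bddAbove

lemma suppFn_continuous (hcomp : IsCompact K) : Continuous (suppFn K) := by
  unfold suppFn
  exact hcomp.continuous_sSup (f := fun x y => ⟪x, y⟫) (by
    simp only [Function.HasUncurry.uncurry, id]; fun_prop)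

lemma suppFn_capBody (hne : K.Nonempty) (hcomp : IsCompact K) (p x : EuclideanSpace ℝ (Fin n)) :
    suppFn (capBody K p) x = max (suppFn K x) ⟪x, p⟫ := by
  have hK := suppFn_isLUB hne hcomp x
  refine IsLUB.csSup_eq ⟨?_, ?_⟩ ?_
  · rintro _ ⟨y, hy, rfl⟩
    have hc : Convex ℝ {y : EuclideanSpace ℝ (Fin n) | ⟪x, y⟫ ≤ max (suppFn K x) ⟪x, p⟫} :=
      convex_halfSpace_le (innerₛₗ ℝ x).isLinear _
    refine convexHull_min ?_ hc hy
    rintro z (hz | rfl)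
    · have hz' : ⟪x, z⟫ ≤ suppFn K x := hK.1 ⟨z, hz, rfl⟩
      exact hz'.trans (le_max_left _ _)
    · exact le_max_right (suppFn K x) ⟪x, z⟫
  · intro b hb
    refine max_le (hK.2 ?_) (hb ⟨p, subset_convexHull ℝ _ (Or.inr rfl), rfl⟩)
    rintro _ ⟨y, hy, rfl⟩
    exact hb ⟨y, subset_convexHull ℝ _ (Or.inl hy), rfl⟩
  · exact ⟨_, p, subset_convexHull ℝ _ (Or.inr rfl), rfl⟩

lemma mem_normalCone_iff (hne : K.Nonempty) (hcomp : IsCompact K)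
    (p x : EuclideanSpace ℝ (Fin n)) :
    x ∈ normalCone K p ↔ suppFn K x ≤ ⟪x, p⟫ := by
  have hK := suppFn_isLUB hne hcomp x
  constructor
  · intro h
    refine hK.2 ?_
    rintro _ ⟨y, hy, rfl⟩
    have := h y hy
    rw [inner_sub_right] at this
    simp only; linarith
  · intro h y hy
    have : ⟪x, y⟫ ≤ suppFn K x := hK.1 ⟨y, hy, rfl⟩
    rw [inner_sub_right]; linarith

lemma mem_normalCone_capBody_iff (hne : K.Nonempty) (hcomp : IsCompact K)
    (p x : EuclideanSpace ℝ (Fin n)) :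
    x ∈ normalCone (capBody K p) p ↔ suppFn K x ≤ ⟪x, p⟫ := by
  have hK := suppFn_isLUB hne hcomp x
  constructor
  · intro h
    exact (mem_normalCone_iff hne hcomp p x).1
      fun y hy => h y (subset_convexHull ℝ _ (Or.inl hy))
  · intro h y hy
    have hc : Convex ℝ {y : EuclideanSpace ℝ (Fin n) | ⟪x, y⟫ ≤ ⟪x, p⟫} :=
      convex_halfSpace_le (innerₛₗ ℝ x).isLinear _
    have : ⟪x, y⟫ ≤ ⟪x, p⟫ := by
      refine convexHull_min ?_ hc hy
      rintro z (hz | rfl)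
      · have hz' : ⟪x, z⟫ ≤ suppFn K x := hK.1 ⟨z, hz, rfl⟩
        exact hz'.trans h
      · exact le_refl ⟪x, z⟫
    rw [inner_sub_right]; linarith

end geom

/-- first variation of the mean width of cap bodies. -/
theorem firstVariation_meanWidth_capBody {n : ℕ} (hn : 2 ≤ n)
    (K : Set (EuclideanSpace ℝ (Fin n)))
    (hne : K.Nonempty) (hcomp : IsCompact K) (hconv : Convex ℝ K)
    (p₀ : EuclideanSpace ℝ (Fin n)) (hp₀ : p₀ ∈ frontier K)
    (u : EuclideanSpace ℝ (Fin n)) (hu : u ∉ supportCone K p₀) (hu0 : u ≠ 0) :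
    (∀ ε : ℝ, 0 < ε →
      (sphereArea n / 2) * (meanWidth (capBody K (p₀ + ε • u)) - meanWidth K) =
        ε * (∫ θ in sphere (0 : EuclideanSpace ℝ (Fin n)) 1 ∩
              (normalCone K p₀ ∩ {z | 0 ≤ ⟪z, u⟫}), ⟪θ, u⟫ ∂(sphereMeasure n)) +
        (∫ θ in sphere (0 : EuclideanSpace ℝ (Fin n)) 1 ∩
              (normalCone (capBody K (p₀ + ε • u)) (p₀ + ε • u) \
                (normalCone K p₀ ∩ {z | 0 ≤ ⟪z, u⟫})),
            (suppFn (capBody K (p₀ + ε • u)) θ - suppFn K θ) ∂(sphereMeasure n))) ∧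
    (∀ ε : ℝ, 0 < ε →
      0 ≤ ∫ θ in sphere (0 : EuclideanSpace ℝ (Fin n)) 1 ∩
              (normalCone (capBody K (p₀ + ε • u)) (p₀ + ε • u) \
                (normalCone K p₀ ∩ {z | 0 ≤ ⟪z, u⟫})),
            (suppFn (capBody K (p₀ + ε • u)) θ - suppFn K θ) ∂(sphereMeasure n)) ∧
    Filter.Tendsto
      (fun ε : ℝ =>
        (∫ θ in sphere (0 : EuclideanSpace ℝ (Fin n)) 1 ∩
              (normalCone (capBody K (p₀ + ε • u)) (p₀ + ε • u) \
                (normalCone K p₀ ∩ {z | 0 ≤ ⟪z, u⟫})),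
            (suppFn (capBody K (p₀ + ε • u)) θ - suppFn K θ) ∂(sphereMeasure n)) / ε)
      (nhdsWithin 0 (Set.Ioi 0)) (nhds 0) := by
  have hp : p₀ ∈ K := hcomp.isClosed.frontier_subset hp₀
  have hfin := sphereMeasure_sphere_lt_top hn
  set μ := sphereMeasure n with hμ
  set S := sphere (0 : EuclideanSpace ℝ (Fin n)) 1 with hS
  have hSm : MeasurableSet S := isClosed_sphere.measurableSet
  have hSc : IsCompact S := isCompact_sphere _ _
  set A : Set (EuclideanSpace ℝ (Fin n)) := normalCone K p₀ ∩ {z | 0 ≤ ⟪z, u⟫} with hA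
  have hkc := suppFn_continuous hcomp
  have hp0le : ∀ θ, ⟪θ, p₀⟫ ≤ suppFn K θ := fun θ => (suppFn_isLUB hne hcomp θ).1 ⟨p₀, hp, rfl⟩
  have hAm : MeasurableSet A := by
    have : A = {θ | suppFn K θ ≤ ⟪θ, p₀⟫} ∩ {z | 0 ≤ ⟪z, u⟫} := by
      ext θ; simp only [hA, mem_inter_iff, mem_normalCone_iff hne hcomp, mem_ofPred_eq]
    rw [this]
    exact ((isClosed_le hkc (by fun_prop)).inter
      (isClosed_le (by fun_prop) (by fun_prop))).measurableSet
  have hNm : ∀ p, MeasurableSet (normalCone (capBody K p) p) := by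
    intro p
    have : normalCone (capBody K p) p = {θ | suppFn K θ ≤ ⟪θ, p⟫} := by
      ext θ; exact mem_normalCone_capBody_iff hne hcomp p θ
    rw [this]
    exact (isClosed_le hkc (by fun_prop)).measurableSet
  have hcc : ∀ p, Continuous (suppFn (capBody K p)) := by
    intro p
    have : suppFn (capBody K p) = fun x => max (suppFn K x) ⟪x, p⟫ :=
      funext (suppFn_capBody hne hcomp p)
    rw [this]; fun_prop
  have : IsFiniteMeasure (μ.restrict S) := ⟨by simpa using hfin⟩
  have hint : ∀ f : EuclideanSpace ℝ (Fin n) → ℝ, Continuous f → IntegrableOn f S μ := by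
    intro f hf
    obtain ⟨C, hC⟩ := hSc.exists_bound_of_continuousOn hf.continuousOn
    exact Measure.integrableOn_of_bounded (M := C) hfin.ne hf.aestronglyMeasurable
      ((ae_restrict_iff' hSm).2 (Filter.Eventually.of_forall hC))
  have hnn : ∀ p θ, 0 ≤ suppFn (capBody K p) θ - suppFn K θ := by
    intro p θ
    rw [suppFn_capBody hne hcomp]
    linarith [le_max_left (suppFn K θ) ⟪θ, p⟫]
  refine ⟨?_, fun ε hε => integral_nonneg fun θ => hnn _ θ, ?_⟩
  · intro ε hε
    set p := p₀ + ε • u with hpdef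
    set N := normalCone (capBody K p) p with hN
    have hAN : A ⊆ N := by
      rintro θ ⟨h1, h2⟩
      rw [mem_normalCone_iff hne hcomp] at h1
      rw [hN, mem_normalCone_capBody_iff hne hcomp, hpdef, inner_add_right, inner_smul_right]
      have := mul_nonneg hε.le h2
      linarith
    have hd : IntegrableOn (fun θ => suppFn (capBody K p) θ - suppFn K θ) S μ :=
      (hint _ (hcc p)).sub (hint _ hkc)
    have hL : (sphereArea n / 2) * (meanWidth (capBody K p) - meanWidth K) =
        ∫ θ in S, (suppFn (capBody K p) θ - suppFn K θ) ∂μ := by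
      rw [integral_sub (hint _ (hcc p)) (hint _ hkc)]
      unfold meanWidth
      by_cases h0 : μ S = 0
      · have : μ.restrict S = 0 := Measure.restrict_eq_zero.2 h0
        rw [← hμ, ← hS, this]; simp
      · have : sphereArea n ≠ 0 := (ENNReal.toReal_pos h0 hfin.ne).ne'
        rw [← hμ, ← hS]
        field_simp
    have hAint : ε * ∫ θ in S ∩ A, ⟪θ, u⟫ ∂μ =
        ∫ θ in S ∩ A, (suppFn (capBody K p) θ - suppFn K θ) ∂μ := by
      rw [← integral_const_mul]
      refine setIntegral_congr_fun (hSm.inter hAm) ?_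
      rintro θ ⟨-, h1, h2⟩
      have h3 := hAN ⟨h1, h2⟩
      rw [mem_normalCone_iff hne hcomp] at h1
      rw [hN, mem_normalCone_capBody_iff hne hcomp] at h3
      simp only
      rw [suppFn_capBody hne hcomp, max_eq_right h3, le_antisymm h1 (hp0le θ), hpdef,
        inner_add_right, inner_smul_right]
      ring
    rw [hL, hAint, ← setIntegral_union ?_ (hSm.inter ((hNm p).diff hAm))
      (hd.mono_set inter_subset_left) (hd.mono_set inter_subset_left)]
    · have hU : S ∩ A ∪ S ∩ (N \ A) = S ∩ N := by
        rw [← inter_union_distrib_left, union_sdiff_cancel hAN]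
      rw [hU]
      refine setIntegral_eq_of_subset_of_forall_sdiff_eq_zero hSm inter_subset_left ?_
      rintro θ ⟨h1, h2⟩
      have h3 : ¬ suppFn K θ ≤ ⟪θ, p⟫ := fun h =>
        h2 ⟨h1, (mem_normalCone_capBody_iff hne hcomp p θ).2 h⟩
      rw [suppFn_capBody hne hcomp, max_eq_left (not_le.1 h3).le, sub_self]
    · exact Set.disjoint_left.2 fun θ h1 h2 => h2.2.2 h1.2
  · let F : ℝ → EuclideanSpace ℝ (Fin n) → ℝ := fun ε =>
      (normalCone (capBody K (p₀ + ε • u)) (p₀ + ε • u) \ A).indicator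
        (fun θ => (suppFn (capBody K (p₀ + ε • u)) θ - suppFn K θ) / ε)
    have hF : ∀ ε, (∫ θ in S ∩ (normalCone (capBody K (p₀ + ε • u)) (p₀ + ε • u) \ A),
        (suppFn (capBody K (p₀ + ε • u)) θ - suppFn K θ) ∂μ) / ε = ∫ θ in S, F ε θ ∂μ := by
      intro ε
      rw [setIntegral_indicator ((hNm _).diff hAm), integral_div]
    simp_rw [hF]
    have hlim : Filter.Tendsto (fun ε => ∫ θ in S, F ε θ ∂μ) (nhdsWithin 0 (Set.Ioi 0))
        (nhds (∫ θ in S, (0 : ℝ) ∂μ)) := by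
      refine tendsto_integral_filter_of_dominated_convergence (fun θ => ‖⟪θ, u⟫‖) ?_ ?_
        (hint _ (by fun_prop)) ?_
      · refine Filter.Eventually.of_forall fun ε => ?_
        exact (((hcc _).sub hkc).div_const ε).aestronglyMeasurable.indicator ((hNm _).diff hAm)
      · filter_upwards [self_mem_nhdsWithin] with ε hε
        have hε : 0 < ε := hε
        refine Filter.Eventually.of_forall fun θ => ?_
        simp only [F]
        by_cases hθ : θ ∈ normalCone (capBody K (p₀ + ε • u)) (p₀ + ε • u) \ A
        · rw [indicator_of_mem hθ, Real.norm_of_nonneg (div_nonneg (hnn _ θ) hε.le),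
            div_le_iff₀ hε, suppFn_capBody hne hcomp,
            max_eq_right ((mem_normalCone_capBody_iff hne hcomp _ _).1 hθ.1),
            inner_add_right, inner_smul_right]
          have h1 := hp0le θ
          have h2 := mul_le_mul_of_nonneg_left (le_abs_self ⟪θ, u⟫) hε.le
          rw [Real.norm_eq_abs]
          linarith
        · rw [indicator_of_notMem hθ]; simp
      · refine Filter.Eventually.of_forall fun θ => ?_
        refine tendsto_const_nhds.congr' ?_
        by_cases h1 : suppFn K θ ≤ ⟪θ, p₀⟫
        · filter_upwards [self_mem_nhdsWithin] with ε hε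
          have hε : 0 < ε := hε
          symm
          refine indicator_of_notMem ?_ _
          rintro ⟨h2, h3⟩
          rw [mem_normalCone_capBody_iff hne hcomp, inner_add_right, inner_smul_right] at h2
          refine h3 ⟨(mem_normalCone_iff hne hcomp _ _).2 h1, ?_⟩
          have := hp0le θ
          exact nonneg_of_mul_nonneg_right (by linarith : 0 ≤ ε * ⟪θ, u⟫) hε
        · have ht : Filter.Tendsto (fun ε : ℝ => ⟪θ, p₀ + ε • u⟫) (nhdsWithin 0 (Set.Ioi 0))
              (nhds ⟪θ, p₀⟫) := by
            have hc : Continuous (fun ε : ℝ => ⟪θ, p₀ + ε • u⟫) := by fun_prop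
            have := hc.tendsto 0
            simp only [zero_smul, add_zero] at this
            exact this.mono_left nhdsWithin_le_nhds
          filter_upwards [ht.eventually_lt_const (not_le.1 h1)] with ε hε
          symm
          refine indicator_of_notMem ?_ _
          rintro ⟨h2, h3⟩
          rw [mem_normalCone_capBody_iff hne hcomp] at h2
          linarith
    simpa using hlim

end
end

section
/- Let n ≥ 2 and let Ω₁ ⊆ Ω₂ be nonempty compact convex subsets of ℝⁿ. Then c_n · dist(Ω₁, Ω₂)ⁿ ≤ diam(Ω₂)^{n−1} · (w(Ω₂) − w(Ω₁)), where dist denotes the Hausdorff distance, diam the diameter, and c_n = 2^{−(n−1)} ω_{n−1} / ((n−1) ω_n) with ω_k = σ_k(S^{k−1}) the surface measure of the unit sphere in ℝ^k. -/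
open Set Metric MeasureTheory
open scoped RealInnerProductSpace

noncomputable section

open Filter Topology ENNReal in
lemma eilenberg_aux {X : Type*} [MetricSpace X] [MeasurableSpace X] [BorelSpace X]
    (f : X → ℝ) (hf : LipschitzWith 1 f) (d : ℝ) (hd : 0 ≤ d) (A : Set X) :
    ∫⁻ t : ℝ, μH[d] (A ∩ f ⁻¹' {t}) ≤ μH[d + 1] A := by
  by_cases htop : μH[d + 1] A = ⊤
  · rw [htop]; exact le_top
  have hex : ∀ j : ℕ, ∃ E : ℕ → Set X, A ⊆ ⋃ i, E i ∧ (∀ i, ediam (E i) ≤ ((j : ℝ≥0∞) + 1)⁻¹) ∧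
      ∑' i, ⨆ _ : (E i).Nonempty, ediam (E i) ^ (d + 1) < μH[d + 1] A + ((j : ℝ≥0∞) + 1)⁻¹ := by
    intro j
    have hpos : (0 : ℝ≥0∞) < ((j : ℝ≥0∞) + 1)⁻¹ := by
      apply ENNReal.inv_pos.2; finiteness
    have h1 : (⨅ (t : ℕ → Set X) (_ : A ⊆ ⋃ n, t n) (_ : ∀ n, ediam (t n) ≤ ((j : ℝ≥0∞) + 1)⁻¹),
          ∑' n, ⨆ _ : (t n).Nonempty, ediam (t n) ^ (d + 1)) ≤ μH[d + 1] A := by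
      rw [Measure.hausdorffMeasure_apply (d + 1) A]
      exact le_iSup₂_of_le (((j : ℝ≥0∞) + 1)⁻¹) hpos le_rfl
    have h2 := h1.trans_lt (ENNReal.lt_add_right htop hpos.ne')
    simp only [iInf_lt_iff] at h2
    obtain ⟨E, h3, h4, h5⟩ := h2
    exact ⟨E, h3, h4, h5⟩
  choose E hE1 hE2 hE3 using hex
  have hr : Tendsto (fun j : ℕ => ((j : ℝ≥0∞) + 1)⁻¹) atTop (𝓝 0) := by
    have := (tendsto_add_atTop_iff_nat 1).2 ENNReal.tendsto_inv_nat_nhds_zero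
    simpa using this
  let I : ℕ → ℕ → Set ℝ := fun j i => closure (f '' E j i)
  have hI : ∀ j i, MeasurableSet (I j i) := fun j i => isClosed_closure.measurableSet
  let F : ℕ → ℝ → ℝ≥0∞ := fun j t => ∑' i, (I j i).indicator (fun _ => ediam (E j i) ^ d) t
  have hFm : ∀ j, Measurable (F j) := fun j =>
    Measurable.tsum fun i => measurable_const.indicator (hI j i)
  have hpt : ∀ t : ℝ, μH[d] (A ∩ f ⁻¹' {t}) ≤ liminf (fun j => F j t) atTop := by
    intro t
    have := Measure.hausdorffMeasure_le_liminf_tsum (ι := fun j => {i : ℕ // t ∈ I j i}) d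
      (A ∩ f ⁻¹' {t}) (l := atTop) (fun j : ℕ => ((j : ℝ≥0∞) + 1)⁻¹) hr (fun j i => E j i)
      (Eventually.of_forall fun j i => hE2 j i)
      (Eventually.of_forall fun j x hx => by
        obtain ⟨i, hi⟩ := mem_iUnion.1 (hE1 j hx.1)
        refine mem_iUnion.2 ⟨⟨i, ?_⟩, hi⟩
        exact subset_closure ⟨x, hi, hx.2⟩)
    refine this.trans (le_of_eq ?_)
    congr 1
    ext j
    have h := tsum_subtype {i : ℕ | t ∈ I j i} (fun i => ediam (E j i) ^ d)
    refine h.trans ?_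
    rfl
  have hint : ∀ j, ∫⁻ t, F j t ≤ μH[d + 1] A + ((j : ℝ≥0∞) + 1)⁻¹ := by
    intro j
    refine le_trans ?_ (hE3 j).le
    rw [lintegral_tsum fun i => (measurable_const.indicator (hI j i)).aemeasurable]
    refine ENNReal.tsum_le_tsum fun i => ?_
    rw [lintegral_indicator_const (hI j i)]
    rcases (E j i).eq_empty_or_nonempty with he | hne
    · simp [I, he]
    · simp only [hne, iSup_pos]
      rw [ENNReal.rpow_add_of_nonneg _ _ hd zero_le_one, ENNReal.rpow_one]
      gcongr
      refine (Real.volume_le_diam _).trans ?_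
      simp only [I, ediam_closure]
      simpa using hf.ediam_image_le (E j i)
  calc ∫⁻ t : ℝ, μH[d] (A ∩ f ⁻¹' {t}) ≤ ∫⁻ t, liminf (fun j => F j t) atTop := lintegral_mono hpt
    _ ≤ liminf (fun j => ∫⁻ t, F j t) atTop := lintegral_liminf_le hFm
    _ ≤ liminf (fun j : ℕ => μH[d + 1] A + ((j : ℝ≥0∞) + 1)⁻¹) atTop :=
        liminf_le_liminf (Eventually.of_forall hint)
    _ = μH[d + 1] A := by
        have : Tendsto (fun j : ℕ => μH[d + 1] A + ((j : ℝ≥0∞) + 1)⁻¹) atTop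
            (𝓝 (μH[d + 1] A + 0)) := tendsto_const_nhds.add hr
        rw [this.liminf_eq, add_zero]

lemma ball_aux (m : ℕ) (ρ : ℝ) (hρ : 0 ≤ ρ) :
    ENNReal.ofReal (ρ ^ (m + 1) / (m + 1)) *
        μH[(m : ℝ)] (sphere (0 : EuclideanSpace ℝ (Fin (m + 1))) 1) ≤
      μH[(m : ℝ) + 1] (closedBall (0 : EuclideanSpace ℝ (Fin (m + 1))) ρ) := by
  refine le_trans ?_ (eilenberg_aux (fun x => ‖x‖) lipschitzWith_one_norm (m : ℝ) m.cast_nonneg _)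
  have h1 : ∀ t : ℝ, (Ioc 0 ρ).indicator (fun t => ENNReal.ofReal (t ^ m) *
      μH[(m : ℝ)] (sphere (0 : EuclideanSpace ℝ (Fin (m + 1))) 1)) t ≤
      μH[(m : ℝ)] (closedBall (0 : EuclideanSpace ℝ (Fin (m + 1))) ρ ∩ (fun x => ‖x‖) ⁻¹' {t}) := by
    intro t
    by_cases ht : t ∈ Ioc 0 ρ
    · rw [indicator_of_mem ht]
      have h2 := Measure.hausdorffMeasure_smul₀ (𝕜 := ℝ) (d := (m : ℝ)) m.cast_nonneg ht.1.ne'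
        (sphere (0 : EuclideanSpace ℝ (Fin (m + 1))) 1)
      rw [smul_sphere' ht.1.ne', smul_zero, Real.norm_of_nonneg ht.1.le, mul_one] at h2
      have h3 : closedBall (0 : EuclideanSpace ℝ (Fin (m + 1))) ρ ∩ (fun x => ‖x‖) ⁻¹' {t} =
          sphere 0 t := by
        ext x
        simp only [mem_inter_iff, mem_closedBall_zero_iff, mem_preimage, mem_singleton_iff,
          mem_sphere_zero_iff_norm]
        exact ⟨fun h => h.2, fun h => ⟨h ▸ ht.2, h⟩⟩
      rw [h3, h2, ENNReal.smul_def, smul_eq_mul]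
      gcongr
      rw [NNReal.rpow_natCast, ENNReal.coe_pow, ENNReal.ofReal_pow ht.1.le]
      gcongr
      rw [Real.nnnorm_of_nonneg ht.1.le, ENNReal.ofReal_eq_coe_nnreal ht.1.le]
    · rw [indicator_of_notMem ht]; exact bot_le
  refine le_trans (le_of_eq ?_) (lintegral_mono h1)
  rw [lintegral_indicator measurableSet_Ioc, lintegral_mul_const _ (by fun_prop)]
  congr 1
  rw [← ofReal_integral_eq_lintegral_ofReal]
  · rw [← intervalIntegral.integral_of_le hρ, integral_pow]; simp
  · exact (intervalIntegral.intervalIntegrable_pow m).1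
  · filter_upwards [ae_restrict_mem measurableSet_Ioc] with t ht
    exact pow_nonneg ht.1.le _

lemma cap_aux (m : ℕ) (u : EuclideanSpace ℝ (Fin (m + 2))) (hu : ‖u‖ = 1) (ρ : ℝ) (hρ : 0 ≤ ρ)
    (hρ1 : ρ ≤ 1) :
    ENNReal.ofReal (ρ ^ (m + 1) / (m + 1)) *
        μH[(m : ℝ)] (sphere (0 : EuclideanSpace ℝ (Fin (m + 1))) 1) ≤
      μH[(m : ℝ) + 1] {θ : EuclideanSpace ℝ (Fin (m + 2)) | ‖θ‖ = 1 ∧ 0 ≤ ⟪u, θ⟫ ∧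
        ‖θ - ⟪u, θ⟫ • u‖ ≤ ρ} := by
  refine (ball_aux m ρ hρ).trans ?_
  have : Fact (Module.finrank ℝ (EuclideanSpace ℝ (Fin (m + 2))) = (m + 1) + 1) := ⟨by simp⟩
  have hu0 : u ≠ 0 := by rintro rfl; simp at hu
  let e := (OrthonormalBasis.fromOrthogonalSpanSingleton (𝕜 := ℝ) (m + 1) hu0).repr
  let K : Submodule ℝ (EuclideanSpace ℝ (Fin (m + 2))) := (Submodule.span ℝ {u})ᗮ
  let P : EuclideanSpace ℝ (Fin (m + 2)) → EuclideanSpace ℝ (Fin (m + 1)) :=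
    fun x => e (K.orthogonalProjectionOnto x)
  have hP : LipschitzWith 1 P := by
    have := e.isometry.lipschitz.comp (Submodule.lipschitzWith_orthogonalProjectionOnto K)
    rw [one_mul] at this
    exact this
  set C := {θ : EuclideanSpace ℝ (Fin (m + 2)) | ‖θ‖ = 1 ∧ 0 ≤ ⟪u, θ⟫ ∧
        ‖θ - ⟪u, θ⟫ • u‖ ≤ ρ} with hC
  have hsub : closedBall (0 : EuclideanSpace ℝ (Fin (m + 1))) ρ ⊆ P '' C := by
    intro y hy
    rw [mem_closedBall_zero_iff] at hy
    set w : K := e.symm y with hw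
    have hwn : ‖(w : EuclideanSpace ℝ (Fin (m + 2)))‖ = ‖y‖ := by
      exact e.symm.norm_map y
    have huw : ⟪u, (w : EuclideanSpace ℝ (Fin (m + 2)))⟫ = 0 :=
      Submodule.mem_orthogonal_singleton_iff_inner_right.1 w.2
    have huu : ⟪u, u⟫ = 1 := by rw [real_inner_self_eq_norm_sq, hu]; norm_num
    have h1y : 0 ≤ 1 - ‖y‖ ^ 2 := by nlinarith [norm_nonneg y]
    set a := Real.sqrt (1 - ‖y‖ ^ 2) with ha
    have ha2 : a ^ 2 = 1 - ‖y‖ ^ 2 := Real.sq_sqrt h1y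
    have hin : ⟪u, (w : EuclideanSpace ℝ (Fin (m + 2))) + a • u⟫ = a := by
      rw [inner_add_right, inner_smul_right, huw, huu]; ring
    refine ⟨w + a • u, ⟨?_, ?_, ?_⟩, ?_⟩
    · have : ‖(w : EuclideanSpace ℝ (Fin (m + 2))) + a • u‖ ^ 2 = 1 := by
        rw [norm_add_sq_real, inner_smul_right, real_inner_comm, huw, norm_smul, hu, hwn, mul_one,
          Real.norm_eq_abs, sq_abs, ha2]; ring
      nlinarith [norm_nonneg ((w : EuclideanSpace ℝ (Fin (m + 2))) + a • u)]
    · rw [hin]; exact Real.sqrt_nonneg _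
    · rw [hin, add_sub_cancel_right, hwn]; exact hy
    · have h0 : K.orthogonalProjectionOnto (a • u) = 0 := by
        rw [Submodule.orthogonalProjectionOnto_eq_zero_iff]
        exact Submodule.le_orthogonal_orthogonal _
          (Submodule.smul_mem _ _ (Submodule.mem_span_singleton_self u))
      simp only [P]
      rw [map_add, h0, add_zero, Submodule.orthogonalProjectionOnto_mem_subspace_eq_self, hw]
      simp
  refine (measure_mono hsub).trans ?_
  simpa using hP.hausdorffMeasure_image_le (d := (m : ℝ) + 1) (by positivity) C

lemma continuous_suppFn {n : ℕ} {C : Set (EuclideanSpace ℝ (Fin n))} (hC : IsCompact C) :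
    Continuous (suppFn C) := by
  unfold suppFn
  exact hC.continuous_sSup (f := fun x y => ⟪x, y⟫)
    (by simpa [Function.HasUncurry.uncurry] using continuous_inner)

lemma bddAbove_inner {n : ℕ} {C : Set (EuclideanSpace ℝ (Fin n))} (hC : IsCompact C)
    (x : EuclideanSpace ℝ (Fin n)) : BddAbove ((fun y => ⟪x, y⟫) '' C) :=
  (hC.image (by fun_prop)).bddAbove

lemma integrableOn_suppFn {n : ℕ} {C : Set (EuclideanSpace ℝ (Fin n))} (hC : IsCompact C)
    (hfin : sphereMeasure n (sphere (0 : EuclideanSpace ℝ (Fin n)) 1) ≠ ⊤) :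
    IntegrableOn (suppFn C) (sphere (0 : EuclideanSpace ℝ (Fin n)) 1) (sphereMeasure n) := by
  obtain ⟨M, hM⟩ := (isCompact_sphere (0 : EuclideanSpace ℝ (Fin n)) 1).exists_bound_of_continuousOn
    (continuous_suppFn hC).continuousOn
  refine Measure.integrableOn_of_bounded (M := M) hfin
    (continuous_suppFn hC).aestronglyMeasurable ?_
  filter_upwards [ae_restrict_mem isClosed_sphere.measurableSet] with x hx using hM x hx

/-- The pointwise estimate on the cap. -/
lemma inner_cap_bound {n : ℕ} (u θ z : EuclideanSpace ℝ (Fin n)) (hu : ‖u‖ = 1) (hθ : ‖θ‖ = 1)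
    (d D : ℝ) (hd : 0 < d) (hD : 0 < D) (ha : 0 ≤ ⟪u, θ⟫) (hb : d ≤ ⟪u, z⟫) (hz : ‖z‖ ≤ D)
    (hr : ‖θ - ⟪u, θ⟫ • u‖ ≤ d / D / 2) : d / 2 ≤ ⟪θ, z⟫ := by
  set a := ⟪u, θ⟫ with ha'
  set b := ⟪u, z⟫ with hb'
  set w := θ - a • u with hw
  set v := z - b • u with hv
  have huu : ⟪u, u⟫ = 1 := by rw [real_inner_self_eq_norm_sq, hu]; norm_num
  have huw : ⟪u, w⟫ = 0 := by
    rw [hw, inner_sub_right, inner_smul_right, huu, ← ha']; ring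
  have huv : ⟪u, v⟫ = 0 := by
    rw [hv, inner_sub_right, inner_smul_right, huu, ← hb']; ring
  have hθe : θ = w + a • u := by rw [hw]; abel
  have hze : z = v + b • u := by rw [hv]; abel
  have hw2 : ‖w‖ ^ 2 + a ^ 2 = 1 := by
    have h : ‖w + a • u‖ ^ 2 = 1 := by rw [← hθe, hθ]; norm_num
    rw [norm_add_sq_real, inner_smul_right, real_inner_comm, huw, norm_smul, hu, mul_one,
          Real.norm_eq_abs, sq_abs] at h
    linarith
  have hv2 : ‖v‖ ^ 2 + b ^ 2 ≤ D ^ 2 := by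
    have h : ‖v + b • u‖ ^ 2 ≤ D ^ 2 := by
      rw [← hze]; exact pow_le_pow_left₀ (norm_nonneg _) hz 2
    rw [norm_add_sq_real, inner_smul_right, real_inner_comm, huv, norm_smul, hu, mul_one,
          Real.norm_eq_abs, sq_abs] at h
    linarith
  have hin : ⟪θ, z⟫ = ⟪w, v⟫ + a * b := by
    rw [hθe, hze, inner_add_left, inner_add_right, inner_add_right, inner_smul_left,
      inner_smul_right, inner_smul_right, inner_smul_left, huv, real_inner_comm, huu,
      real_inner_comm u w, huw]
    simp [real_inner_comm, mul_comm]
  have hwv : -(‖w‖ * ‖v‖) ≤ ⟪w, v⟫ := (abs_le.1 (abs_real_inner_le_norm w v)).1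
  have hwD : ‖w‖ * D ≤ b / 2 := by
    have : ‖w‖ * D ≤ d / D / 2 * D := by gcongr
    have h2 : d / D / 2 * D = d / 2 := by field_simp
    linarith
  have hb0 : 0 < b := hd.trans_le hb
  have hvD : ‖v‖ ≤ D := by nlinarith [norm_nonneg v]
  have hwn := norm_nonneg w
  have hvn := norm_nonneg v
  have key : b / 2 + ‖w‖ * ‖v‖ ≤ a * b := by
    refine (sq_le_sq₀ (by positivity) (by positivity)).1 ?_
    · have e1 : ‖w‖ * ‖v‖ ≤ b / 2 := (mul_le_mul_of_nonneg_left hvD hwn).trans hwD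
      have e2 : (‖w‖ * D) ^ 2 ≤ (b / 2) ^ 2 := pow_le_pow_left₀ (by positivity) hwD 2
      have e3 : ‖w‖ ^ 2 * (‖v‖ ^ 2 + b ^ 2) ≤ ‖w‖ ^ 2 * D ^ 2 := by gcongr
      have e4 : b * (‖w‖ * ‖v‖) ≤ b * (b / 2) := by gcongr
      have e5 : (a * b) ^ 2 = (1 - ‖w‖ ^ 2) * b ^ 2 := by rw [← hw2]; ring
      rw [e5]
      nlinarith
  linarith

/-- lower bound of the mean width gap by the Hausdorff distance. -/
theorem hausdorffDist_pow_le_meanWidth_gap {n : ℕ} (hn : 2 ≤ n)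
    (Ω₁ Ω₂ : Set (EuclideanSpace ℝ (Fin n)))
    (h1ne : Ω₁.Nonempty) (h1c : IsCompact Ω₁) (h1v : Convex ℝ Ω₁)
    (h2ne : Ω₂.Nonempty) (h2c : IsCompact Ω₂) (h2v : Convex ℝ Ω₂)
    (hsub : Ω₁ ⊆ Ω₂) :
    ((2 : ℝ) ^ (-((n : ℝ) - 1)) * sphereArea (n - 1) / (((n : ℝ) - 1) * sphereArea n)) *
        hausdorffDist Ω₁ Ω₂ ^ n ≤
      Metric.diam Ω₂ ^ (n - 1) * (meanWidth Ω₂ - meanWidth Ω₁) := by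
  by_cases hA : sphereArea n = 0
  · simp [meanWidth, hA]
  have hA0 : 0 ≤ sphereArea n := ENNReal.toReal_nonneg
  have hApos : 0 < sphereArea n := lt_of_le_of_ne hA0 (Ne.symm hA)
  have hfin : sphereMeasure n (sphere (0 : EuclideanSpace ℝ (Fin n)) 1) ≠ ⊤ := by
    intro h; apply hA; simp [sphereArea, h]
  have hi1 := integrableOn_suppFn h1c hfin
  have hi2 := integrableOn_suppFn h2c hfin
  have hgap : meanWidth Ω₂ - meanWidth Ω₁ = (2 / sphereArea n) *
      ∫ θ in sphere (0 : EuclideanSpace ℝ (Fin n)) 1, (suppFn Ω₂ θ - suppFn Ω₁ θ)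
        ∂(sphereMeasure n) := by
    rw [integral_sub hi2 hi1, meanWidth, meanWidth]; ring
  have hmono : ∀ θ, 0 ≤ suppFn Ω₂ θ - suppFn Ω₁ θ := fun θ => sub_nonneg.2
    (csSup_le_csSup (bddAbove_inner h2c θ) (h1ne.image _) (image_mono hsub))
  obtain ⟨p, hp, hpmax⟩ := h2c.exists_isMaxOn h2ne (continuous_infDist_pt Ω₁).continuousOn
  obtain ⟨q, hq, hpq⟩ := h1c.exists_infDist_eq_dist h1ne p
  set d := infDist p Ω₁ with hd
  have hd0 : 0 ≤ d := infDist_nonneg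
  have hHd : hausdorffDist Ω₁ Ω₂ ≤ d := by
    refine hausdorffDist_le_of_infDist hd0 (fun x hx => ?_) (fun x hx => hpmax hx)
    rw [infDist_zero_of_mem (hsub hx)]; exact hd0
  have hgap0 : 0 ≤ meanWidth Ω₂ - meanWidth Ω₁ := by
    rw [hgap]
    exact mul_nonneg (by positivity) (integral_nonneg hmono)
  obtain ⟨m, rfl⟩ : ∃ m, n = m + 2 := ⟨n - 2, by omega⟩
  have hc : 0 ≤ ((2 : ℝ) ^ (-(((m + 2 : ℕ) : ℝ) - 1)) * sphereArea (m + 2 - 1) /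
      ((((m + 2 : ℕ) : ℝ) - 1) * sphereArea (m + 2))) := by
    have h1 : (0 : ℝ) ≤ ((m + 2 : ℕ) : ℝ) - 1 := by push_cast; linarith [m.cast_nonneg (α := ℝ)]
    have h2 : 0 ≤ sphereArea (m + 2 - 1) := ENNReal.toReal_nonneg
    positivity
  refine (mul_le_mul_of_nonneg_left (pow_le_pow_left₀ hausdorffDist_nonneg hHd _) hc).trans ?_
  rcases hd0.eq_or_lt with hdz | hdpos
  · rw [← hdz, zero_pow (by omega), mul_zero]
    exact mul_nonneg (pow_nonneg diam_nonneg _) hgap0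
  set D := Metric.diam Ω₂ with hD
  have hdD : d ≤ D := by
    rw [hpq]; exact dist_le_diam_of_mem h2c.isBounded hp (hsub hq)
  have hDpos : 0 < D := hdpos.trans_le hdD
  have hnpq : ‖p - q‖ = d := by rw [hpq, dist_eq_norm]
  set u := d⁻¹ • (p - q) with hu
  have hu1 : ‖u‖ = 1 := by
    rw [hu, norm_smul, hnpq, norm_inv, Real.norm_of_nonneg hd0, inv_mul_cancel₀ hdpos.ne']
  have hproj : ∀ y ∈ Ω₁, ⟪p - q, y - q⟫ ≤ 0 := by
    refine (norm_eq_iInf_iff_real_inner_le_zero h1v hq).1 ?_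
    rw [hnpq, hd, infDist_eq_iInf]
    simp only [dist_eq_norm]
  have hb : ∀ y ∈ Ω₁, d ≤ ⟪u, p - y⟫ := by
    intro y hy
    have h1 : p - y = (p - q) - (y - q) := by abel
    rw [h1, hu, inner_smul_left, inner_sub_right, real_inner_self_eq_norm_sq, hnpq]
    have h2 := hproj y hy
    have h3 : d = d⁻¹ * d ^ 2 := by field_simp
    calc d = d⁻¹ * d ^ 2 := h3
      _ ≤ d⁻¹ * (d ^ 2 - ⟪p - q, y - q⟫) := by gcongr; linarith
      _ = _ := by simp
  set C := {θ : EuclideanSpace ℝ (Fin (m + 2)) | ‖θ‖ = 1 ∧ 0 ≤ ⟪u, θ⟫ ∧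
        ‖θ - ⟪u, θ⟫ • u‖ ≤ d / D / 2} with hC
  have hCsub : C ⊆ sphere (0 : EuclideanSpace ℝ (Fin (m + 2))) 1 := fun θ hθ => by
    simpa using hθ.1
  have hCm : MeasurableSet C := by
    apply IsClosed.measurableSet
    have c1 : IsClosed {θ : EuclideanSpace ℝ (Fin (m + 2)) | ‖θ‖ = 1} :=
      isClosed_eq (by fun_prop) (by fun_prop)
    have c2 : IsClosed {θ : EuclideanSpace ℝ (Fin (m + 2)) | 0 ≤ ⟪u, θ⟫} :=
      isClosed_le (by fun_prop) (by fun_prop)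
    have c3 : IsClosed {θ : EuclideanSpace ℝ (Fin (m + 2)) | ‖θ - ⟪u, θ⟫ • u‖ ≤ d / D / 2} :=
      isClosed_le (by fun_prop) (by fun_prop)
    exact c1.inter (c2.inter c3)
  have hCfin : sphereMeasure (m + 2) C ≠ ⊤ := measure_ne_top_of_subset hCsub hfin
  have hpt : ∀ θ ∈ C, d / 2 ≤ suppFn Ω₂ θ - suppFn Ω₁ θ := by
    intro θ hθ
    have h2 : ⟪θ, p⟫ ≤ suppFn Ω₂ θ := le_csSup (bddAbove_inner h2c θ) (mem_image_of_mem _ hp)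
    have h1 : suppFn Ω₁ θ ≤ ⟪θ, p⟫ - d / 2 := by
      refine csSup_le (h1ne.image _) ?_
      rintro _ ⟨y, hy, rfl⟩
      have := inner_cap_bound u θ (p - y) hu1 hθ.1 d D hdpos hDpos hθ.2.1 (hb y hy)
        (by rw [← dist_eq_norm]; exact dist_le_diam_of_mem h2c.isBounded hp (hsub hy)) hθ.2.2
      rw [inner_sub_right] at this
      simp only
      linarith
    linarith
  have hidiff := hi2.sub hi1
  have hI : d / 2 * (sphereMeasure (m + 2)).real C ≤
      ∫ θ in sphere (0 : EuclideanSpace ℝ (Fin (m + 2))) 1, (suppFn Ω₂ θ - suppFn Ω₁ θ)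
        ∂(sphereMeasure (m + 2)) := by
    refine (setIntegral_ge_of_const_le_real hCm hCfin hpt
      (IntegrableOn.mono_set hidiff hCsub)).trans ?_
    exact setIntegral_mono_set hidiff (Filter.Eventually.of_forall hmono)
      (Filter.Eventually.of_forall hCsub)
  have hcap : (d / D / 2) ^ (m + 1) / (m + 1) * sphereArea (m + 1) ≤
      (sphereMeasure (m + 2)).real C := by
    have h1 : d / D ≤ 1 := (div_le_one hDpos).2 hdD
    have h0 : 0 ≤ d / D / 2 := by positivity
    have h := cap_aux m u hu1 (d / D / 2) h0 (by linarith)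
    have e1 : sphereMeasure (m + 2) = μH[(m : ℝ) + 1] := by
      unfold sphereMeasure; congr 1; push_cast; ring
    have e2 : sphereMeasure (m + 1) = μH[(m : ℝ)] := by
      unfold sphereMeasure; congr 1; push_cast; ring
    rw [← e1, ← e2] at h
    have h' := ENNReal.toReal_mono hCfin h
    rw [ENNReal.toReal_mul, ENNReal.toReal_ofReal (by positivity)] at h'
    exact h'
  rw [hgap]
  have hexp : (2 : ℝ) ^ (-(((m + 2 : ℕ) : ℝ) - 1)) = ((2 : ℝ) ^ (m + 1))⁻¹ := by
    rw [Real.rpow_neg (by norm_num), ← Real.rpow_natCast]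
    congr 2; push_cast; ring
  have hm1 : (((m + 2 : ℕ) : ℝ) - 1) = (m : ℝ) + 1 := by push_cast; ring
  rw [hexp, hm1]
  simp only [show m + 2 - 1 = m + 1 from rfl]
  calc ((2 : ℝ) ^ (m + 1))⁻¹ * sphereArea (m + 1) / (((m : ℝ) + 1) * sphereArea (m + 2)) *
        d ^ (m + 2)
      = D ^ (m + 1) * (2 / sphereArea (m + 2) * (d / 2 *
          ((d / D / 2) ^ (m + 1) / (m + 1) * sphereArea (m + 1)))) := by
        rw [div_pow, div_pow]
        field_simp
        ring
    _ ≤ _ := by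
        gcongr
        exact (mul_le_mul_of_nonneg_left hcap (by positivity)).trans hI

end
end

section
/- Let x : [a,b] → ℝⁿ be a continuous injective self-expanding curve and let t ∈ (a,b]. Then for all p, q in conv(x([a,t])) with p ≠ x(t) and q ≠ x(t), one has ⟨p − x(t), q − x(t)⟩ > 0. -/
open Set Metric MeasureTheory
open scoped RealInnerProductSpace

noncomputable section

/-- A punctured-half-space-with-vertex is convex. -/
lemma convex_vertex_halfspace {n : ℕ} (c w : EuclideanSpace ℝ (Fin n)) :
    Convex ℝ {v : EuclideanSpace ℝ (Fin n) | v = c ∨ 0 < ⟪v - c, w⟫} := by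
  intro u hu v hv α β hα hβ hαβ
  simp only [mem_setOf_eq] at hu hv ⊢
  have key : α • u + β • v - c = α • (u - c) + β • (v - c) := by
    have : c = α • c + β • c := by rw [← add_smul, hαβ, one_smul]
    nth_rewrite 1 [this]
    module
  have hin : ⟪α • u + β • v - c, w⟫ = α * ⟪u - c, w⟫ + β * ⟪v - c, w⟫ := by
    rw [key, inner_add_left, real_inner_smul_left, real_inner_smul_left]
  rcases hα.eq_or_lt with h0 | hα'
  · have hb : β = 1 := by linarith
    subst hb
    subst h0
    simpa using hv
  rcases hβ.eq_or_lt with h0 | hβ'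
  · have hb : α = 1 := by linarith
    subst hb
    subst h0
    simpa using hu
  rw [hin]
  rcases hu with rfl | hu <;> rcases hv with rfl | hv
  · left
    rw [← add_smul, hαβ, one_smul]
  · right
    simpa using mul_pos hβ' hv
  · right
    simpa using mul_pos hα' hu
  · right
    positivity

/-- acute angle property of self expanding curves. -/
theorem selfExpanding_inner_pos {n : ℕ} {a b : ℝ} {x : ℝ → EuclideanSpace ℝ (Fin n)}
    (hx : SelfExpanding a b x) (hinj : Set.InjOn x (Icc a b))
    {t : ℝ} (ht : t ∈ Ioc a b) :
    ∀ p ∈ convexHull ℝ (x '' Icc a t), ∀ q ∈ convexHull ℝ (x '' Icc a t),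
      p ≠ x t → q ≠ x t → 0 < ⟪p - x t, q - x t⟫ := by
  obtain ⟨hta, htb⟩ := ht
  have hne : ∀ s, a ≤ s → s < t → x s - x t ≠ 0 := fun s h1 h2 h =>
    h2.ne (hinj ⟨h1, h2.le.trans htb⟩ ⟨hta.le, htb⟩ (sub_eq_zero.mp h))
  have hpair : ∀ s r, a ≤ s → s ≤ r → r < t → 0 < ⟪x s - x t, x r - x t⟫ := by
    intro s r h1 h2 h3
    have hd := hx.2 s r t h1 h2 h3.le htb
    rw [dist_eq_norm, dist_eq_norm, norm_sub_rev (x t) (x s)] at hd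
    have e : x r - x s = (x r - x t) - (x s - x t) := by abel
    rw [e] at hd
    have hsq := pow_le_pow_left₀ (norm_nonneg _) hd 2
    rw [norm_sub_sq_real, real_inner_comm] at hsq
    have := norm_pos_iff.mpr (hne r (h1.trans h2) h3)
    nlinarith
  have hall : ∀ s ∈ Icc a t, ∀ r ∈ Icc a t, x s ≠ x t → x r ≠ x t →
      0 < ⟪x s - x t, x r - x t⟫ := by
    intro s hs r hr hs' hr'
    have hst : s < t := lt_of_le_of_ne hs.2 (fun h => hs' (by rw [h]))
    have hrt : r < t := lt_of_le_of_ne hr.2 (fun h => hr' (by rw [h]))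
    rcases le_total s r with h | h
    · exact hpair s r hs.1 h hrt
    · rw [real_inner_comm]
      exact hpair r s hr.1 h hst
  have h1 : ∀ r ∈ Icc a t, x r ≠ x t → ∀ p ∈ convexHull ℝ (x '' Icc a t), p ≠ x t →
      0 < ⟪p - x t, x r - x t⟫ := by
    intro r hr hr' p hp hp'
    refine (convexHull_min ?_ (convex_vertex_halfspace (x t) (x r - x t)) hp).resolve_left hp'
    rintro _ ⟨s, hs, rfl⟩
    exact or_iff_not_imp_left.mpr (fun h => hall s hs r hr h hr')
  intro p hp q hq hp' hq'
  rw [real_inner_comm]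
  refine (convexHull_min ?_ (convex_vertex_halfspace (x t) (p - x t)) hq).resolve_left hq'
  rintro _ ⟨s, hs, rfl⟩
  refine or_iff_not_imp_left.mpr (fun h => ?_)
  rw [real_inner_comm]
  exact h1 s hs h p hp hp'

end
end

section
/- Let x : [a,b] → ℝⁿ be a continuous injective self-expanding curve. Then: (i) for every t ∈ (a,b], the point x(t) lies in the relative (intrinsic) boundary of conv(x([a,t])); (ii) for all a ≤ t₁ < t₂ ≤ b, x(t₂) ∉ conv(x([a,t₁])); (iii) for all a ≤ t₁ < t₂ ≤ b, w(conv(x([a,t₁]))) < w(conv(x([a,t₂]))). -/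
open Set Metric MeasureTheory
open scoped RealInnerProductSpace

noncomputable section

lemma se_half {n : ℕ} (p q y : EuclideanSpace ℝ (Fin n)) (h : dist p y ≤ dist q y) :
    ⟪q - p, y⟫ ≤ ⟪q - p, q⟫ - ‖q - p‖ ^ 2 / 2 := by
  rw [dist_eq_norm, dist_eq_norm] at h
  have h1 : p - y = (q - y) - (q - p) := by abel
  have h2 := norm_sub_sq_real (q - y) (q - p)
  rw [← h1] at h2
  have h3 : ‖p - y‖ ^ 2 ≤ ‖q - y‖ ^ 2 := by gcongr
  rw [real_inner_comm, inner_sub_right] at h2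
  linarith

lemma se_hull_le {n : ℕ} {S : Set (EuclideanSpace ℝ (Fin n))} {v : EuclideanSpace ℝ (Fin n)}
    {c : ℝ} (h : ∀ y ∈ S, ⟪v, y⟫ ≤ c) : ∀ y ∈ convexHull ℝ S, ⟪v, y⟫ ≤ c := by
  have : convexHull ℝ S ⊆ {y | ⟪v, y⟫ ≤ c} :=
    convexHull_min h (convex_halfSpace_le (f := fun y => ⟪v, y⟫)
      (innerSL ℝ v).toLinearMap.isLinear c)
  exact this

lemma se_suppFn_hull {n : ℕ} {S : Set (EuclideanSpace ℝ (Fin n))} (hS : IsCompact S)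
    (hne : S.Nonempty) (v : EuclideanSpace ℝ (Fin n)) :
    suppFn (convexHull ℝ S) v = suppFn S v := by
  have hb : BddAbove ((fun y => ⟪v, y⟫) '' S) :=
    (hS.image (by fun_prop)).bddAbove
  have h1 : IsLUB ((fun y => ⟪v, y⟫) '' S) (suppFn S v) :=
    isLUB_csSup (hne.image _) hb
  refine IsLUB.csSup_eq (s := (fun y => ⟪v, y⟫) '' (convexHull ℝ S)) ⟨?_, ?_⟩
    (hne.convexHull.image _)
  · rintro _ ⟨y, hy, rfl⟩
    exact se_hull_le (fun z hz => h1.1 ⟨z, hz, rfl⟩) y hy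
  · intro c hc
    apply h1.2
    rintro _ ⟨y, hy, rfl⟩
    exact hc ⟨y, subset_convexHull ℝ S hy, rfl⟩

lemma se_suppFn_cont {n : ℕ} {S : Set (EuclideanSpace ℝ (Fin n))} (hS : IsCompact S) :
    Continuous (suppFn S) := by
  unfold suppFn
  exact hS.continuous_sSup (f := fun x y => ⟪x, y⟫)
    (by simp only [Function.HasUncurry.uncurry]; fun_prop)

/-- graph chart of the sphere around `v`. -/
def seChart {n : ℕ} (v : EuclideanSpace ℝ (Fin n)) (w : (Submodule.span ℝ {v})ᗮ) :
    EuclideanSpace ℝ (Fin n) := (w : EuclideanSpace ℝ (Fin n)) + √(1 - ‖w‖ ^ 2) • v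

lemma seChart_contDiffAt {n : ℕ} (v : EuclideanSpace ℝ (Fin n)) :
    ContDiffAt ℝ 1 (seChart v) 0 := by
  unfold seChart
  refine ContDiffAt.add ?_ (ContDiffAt.fun_smul ?_ contDiffAt_const)
  · exact ((Submodule.span ℝ {v})ᗮ.subtypeL.contDiff).contDiffAt
  · refine ContDiffAt.sqrt ?_ (by simp)
    exact contDiffAt_const.sub (contDiff_norm_sq ℝ).contDiffAt

lemma seChart_zero {n : ℕ} (v : EuclideanSpace ℝ (Fin n)) : seChart v 0 = v := by
  simp [seChart]

lemma seChart_proj {n : ℕ} (v : EuclideanSpace ℝ (Fin n)) (w : (Submodule.span ℝ {v})ᗮ) :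
    (Submodule.span ℝ {v})ᗮ.orthogonalProjectionOnto (seChart v w) = w := by
  have : (Submodule.span ℝ {v})ᗮ.orthogonalProjectionOnto v = 0 := by
    rw [Submodule.orthogonalProjectionOnto_eq_zero_iff]
    exact Submodule.le_orthogonal_orthogonal _ (Submodule.mem_span_singleton_self v)
  simp [seChart, this]

lemma seChart_inner {n : ℕ} (v : EuclideanSpace ℝ (Fin n)) (w : (Submodule.span ℝ {v})ᗮ) :
    ⟪(w : EuclideanSpace ℝ (Fin n)), v⟫ = 0 := by
  have := w.2
  rw [Submodule.mem_orthogonal_singleton_iff_inner_left] at this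
  exact this

lemma seChart_mem {n : ℕ} {v : EuclideanSpace ℝ (Fin n)} (hv : ‖v‖ = 1)
    (w : (Submodule.span ℝ {v})ᗮ) (hw : ‖w‖ ≤ 1) :
    seChart v w ∈ sphere (0 : EuclideanSpace ℝ (Fin n)) 1 := by
  rw [mem_sphere_zero_iff_norm, ← sq_eq_sq₀ (norm_nonneg _) zero_le_one]
  unfold seChart
  rw [norm_add_sq_real, inner_smul_right, seChart_inner, norm_smul, hv, Real.norm_eq_abs,
    mul_one, sq_abs, Real.sq_sqrt]
  · simp
  · have := norm_nonneg w
    nlinarith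

lemma seChart_surj {n : ℕ} {v : EuclideanSpace ℝ (Fin n)} (hv : ‖v‖ = 1)
    (y : EuclideanSpace ℝ (Fin n)) (hy : ‖y‖ = 1) (hpos : 0 < ⟪v, y⟫) :
    seChart v ((Submodule.span ℝ {v})ᗮ.orthogonalProjectionOnto y) = y := by
  set w := (Submodule.span ℝ {v})ᗮ.orthogonalProjectionOnto y with hw
  have h1 : (w : EuclideanSpace ℝ (Fin n)) = y - ⟪v, y⟫ • v := by
    rw [hw]
    have := Submodule.starProjection_orthogonal_val (K := Submodule.span ℝ {v}) y
    rw [Submodule.starProjection_unit_singleton ℝ hv] at this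
    exact this
  have h2 : ‖w‖ ^ 2 = 1 - ⟪v, y⟫ ^ 2 := by
    rw [Submodule.norm_coe w |>.symm, h1, norm_sub_sq_real, norm_smul, inner_smul_right, hv, hy,
      Real.norm_eq_abs, mul_one, sq_abs, real_inner_comm]
    ring
  unfold seChart
  rw [h2, h1, show 1 - (1 - ⟪v, y⟫ ^ 2) = ⟪v, y⟫ ^ 2 by ring, Real.sqrt_sq hpos.le]
  abel

lemma se_finrank {m : ℕ} {v : EuclideanSpace ℝ (Fin (m + 1))} (hv : ‖v‖ = 1) :
    Module.finrank ℝ (Submodule.span ℝ {v})ᗮ = m := by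
  have : Fact (Module.finrank ℝ (EuclideanSpace ℝ (Fin (m + 1))) = m + 1) := ⟨by simp⟩
  exact Submodule.finrank_orthogonal_span_singleton (by rintro rfl; simp at hv)

lemma se_haar {m : ℕ} {v : EuclideanSpace ℝ (Fin (m + 1))} (hv : ‖v‖ = 1) :
    (μH[(m : ℝ)] : Measure (Submodule.span ℝ {v})ᗮ).IsAddHaarMeasure := by
  have := isAddHaarMeasure_hausdorffMeasure (E := (Submodule.span ℝ {v})ᗮ)
  rwa [se_finrank hv] at this

lemma se_measure_pos {m : ℕ} {v : EuclideanSpace ℝ (Fin (m + 1))} (hv : ‖v‖ = 1)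
    {U : Set (EuclideanSpace ℝ (Fin (m + 1)))} (hU : U ∈ nhds v) :
    0 < sphereMeasure (m + 1) (U ∩ sphere 0 1) := by
  have := se_haar hv
  have h1 : seChart v ⁻¹' U ∩ ball 0 1 ∈ nhds (0 : (Submodule.span ℝ {v})ᗮ) := by
    refine Filter.inter_mem ?_ (ball_mem_nhds _ one_pos)
    apply (seChart_contDiffAt v).continuousAt
    rwa [seChart_zero]
  have h2 := Measure.measure_pos_of_mem_nhds (μH[(m : ℝ)]) h1
  have h3 : sphereMeasure (m + 1) = μH[(m : ℝ)] := by simp [sphereMeasure]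
  rw [h3]
  refine h2.trans_le (le_trans (measure_mono ?_)
    (hausdorffMeasure_orthogonalProjectionOnto_le (Submodule.span ℝ {v})ᗮ m _ (by positivity)))
  rintro w ⟨hw, hw1⟩
  refine ⟨seChart v w, ⟨hw, seChart_mem hv w ?_⟩, seChart_proj v w⟩
  simpa using (mem_ball_zero_iff.1 hw1).le

lemma se_measure_fin (m : ℕ) :
    sphereMeasure (m + 1) (sphere 0 1) < ⊤ := by
  have h3 : sphereMeasure (m + 1) = μH[(m : ℝ)] := by simp [sphereMeasure]
  rw [h3]
  refine (isCompact_sphere _ _).measure_lt_top_of_nhdsWithin fun v hv => ?_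
  have hv : ‖v‖ = 1 := by simpa using hv
  have := se_haar hv
  obtain ⟨K, t, ht, hK⟩ := (seChart_contDiffAt v).exists_lipschitzOnWith
  set P := (Submodule.span ℝ {v})ᗮ.orthogonalProjectionOnto
  have hP0 : P v = 0 := by
    have := seChart_proj v 0
    rwa [seChart_zero] at this
  have ht' : t ∩ ball 0 1 ∈ nhds (P v) := by
    rw [hP0]; exact Filter.inter_mem ht (ball_mem_nhds _ one_pos)
  have hN : P ⁻¹' (t ∩ ball 0 1) ∩ {y | 0 < ⟪v, y⟫} ∈ nhds v := by
    refine Filter.inter_mem (P.continuous.continuousAt ht') ?_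
    refine (isOpen_lt continuous_const (by fun_prop)).mem_nhds ?_
    simp [hv]
  refine ⟨_, Filter.inter_mem (mem_nhdsWithin_of_mem_nhds hN) self_mem_nhdsWithin, ?_⟩
  have hsub : P ⁻¹' (t ∩ ball 0 1) ∩ {y | 0 < ⟪v, y⟫} ∩ sphere 0 1 ⊆
      seChart v '' (t ∩ ball 0 1) := by
    rintro y ⟨⟨hy1, hy2⟩, hy3⟩
    exact ⟨P y, hy1, seChart_surj hv y (by simpa using hy3) hy2⟩
  refine (measure_mono hsub).trans_lt ?_
  refine ((hK.mono inter_subset_left).hausdorffMeasure_image_le (by positivity)).trans_lt ?_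
  refine ENNReal.mul_lt_top (ENNReal.rpow_lt_top_of_nonneg (by positivity) (by simp)) ?_
  exact (measure_mono inter_subset_right).trans_lt measure_ball_lt_top

lemma se_integrable {m : ℕ} {f : EuclideanSpace ℝ (Fin (m + 1)) → ℝ} (hf : Continuous f) :
    IntegrableOn f (sphere 0 1) (sphereMeasure (m + 1)) :=
  hf.continuousOn.integrableOn_of_subset_isCompact (isCompact_sphere _ _)
    isClosed_sphere.measurableSet subset_rfl (se_measure_fin m).ne

lemma se_meanWidth_lt {m : ℕ} {S T : Set (EuclideanSpace ℝ (Fin (m + 1)))}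
    (hS : IsCompact S) (hT : IsCompact T) (hne : S.Nonempty) (hST : S ⊆ T)
    {v : EuclideanSpace ℝ (Fin (m + 1))} (hv : ‖v‖ = 1) (hlt : suppFn S v < suppFn T v) :
    meanWidth (convexHull ℝ S) < meanWidth (convexHull ℝ T) := by
  have e1 : suppFn (convexHull ℝ S) = suppFn S := funext (se_suppFn_hull hS hne)
  have e2 : suppFn (convexHull ℝ T) = suppFn T := funext (se_suppFn_hull hT (hne.mono hST))
  have c1 := se_suppFn_cont hS
  have c2 := se_suppFn_cont hT
  unfold meanWidth
  rw [e1, e2]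
  have harea : 0 < sphereArea (m + 1) := by
    refine ENNReal.toReal_pos ?_ (se_measure_fin m).ne
    have := se_measure_pos hv Filter.univ_mem
    rw [univ_inter] at this
    exact this.ne'
  refine mul_lt_mul_of_pos_left ?_ (by positivity)
  rw [← sub_pos, ← integral_sub (se_integrable c2) (se_integrable c1),
    setIntegral_pos_iff_support_of_nonneg_ae]
  · refine se_measure_pos hv ?_
    refine Filter.mem_of_superset ((isOpen_lt c1 c2).mem_nhds hlt) ?_
    intro y hy
    exact (sub_pos.2 hy).ne'
  · refine Filter.Eventually.of_forall fun y => sub_nonneg.2 ?_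
    exact csSup_le_csSup (hT.image (by fun_prop)).bddAbove (hne.image _) (image_mono hST)
  · exact (se_integrable c2).sub (se_integrable c1)

/-- basic geometric properties of self expanding curves. -/
theorem selfExpanding_geometry {n : ℕ} (hn : 2 ≤ n) {a b : ℝ}
    {x : ℝ → EuclideanSpace ℝ (Fin n)}
    (hx : SelfExpanding a b x) (hinj : Set.InjOn x (Icc a b)) :
    (∀ t ∈ Ioc a b, x t ∈ intrinsicFrontier ℝ (convexHull ℝ (x '' Icc a t))) ∧
    (∀ t₁ t₂, a ≤ t₁ → t₁ < t₂ → t₂ ≤ b → x t₂ ∉ convexHull ℝ (x '' Icc a t₁)) ∧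
    (∀ t₁ t₂, a ≤ t₁ → t₁ < t₂ → t₂ ≤ b →
      meanWidth (convexHull ℝ (x '' Icc a t₁)) < meanWidth (convexHull ℝ (x '' Icc a t₂))) := by
  obtain ⟨hc, hexp⟩ := hx
  have key : ∀ t₁ t₂, a ≤ t₁ → t₁ < t₂ → t₂ ≤ b → 0 < ‖x t₂ - x t₁‖ ∧
      ∀ y ∈ x '' Icc a t₁, ⟪x t₂ - x t₁, y⟫ ≤
        ⟪x t₂ - x t₁, x t₂⟫ - ‖x t₂ - x t₁‖ ^ 2 / 2 := by
    intro t₁ t₂ h1 h2 h3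
    refine ⟨norm_pos_iff.2 (sub_ne_zero.2 fun h => h2.ne' ?_), ?_⟩
    · exact hinj ⟨by linarith, h3⟩ ⟨h1, by linarith⟩ h
    · rintro _ ⟨r, ⟨hr1, hr2⟩, rfl⟩
      exact se_half _ _ _ (hexp r t₁ t₂ hr1 hr2 h2.le h3)
  refine ⟨?_, ?_, ?_⟩
  · rintro t ⟨hat, htb⟩
    have hmem : x t ∈ convexHull ℝ (x '' Icc a t) :=
      subset_convexHull ℝ _ ⟨t, ⟨hat.le, le_rfl⟩, rfl⟩
    have hspan := subset_affineSpan ℝ _ hmem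
    refine ⟨⟨x t, hspan⟩, ⟨subset_closure hmem, fun hint => ?_⟩, rfl⟩
    rw [mem_interior_iff_mem_nhds, Metric.mem_nhds_iff] at hint
    obtain ⟨ε, hε, hball⟩ := hint
    obtain ⟨δ, hδ, hcont⟩ := Metric.continuousWithinAt_iff.1 (hc t ⟨hat.le, htb⟩) (ε / 4)
      (by positivity)
    obtain ⟨s, hs, hst⟩ : ∃ s, max a (t - δ) < s ∧ s < t :=
      exists_between (max_lt hat (by linarith))
    obtain ⟨has, hsδ⟩ := max_lt_iff.1 hs
    obtain ⟨hpos, hk⟩ := key s t has.le hst htb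
    set v := x t - x s with hv
    set c := ε / 2 / ‖v‖ with hcdef
    have hcv : c * ‖v‖ = ε / 2 := by rw [hcdef]; field_simp
    have hc0 : 0 ≤ c := by positivity
    have hsmem : x s ∈ affineSpan ℝ (convexHull ℝ (x '' Icc a t)) :=
      subset_affineSpan ℝ _ (subset_convexHull ℝ _ ⟨s, ⟨has.le, hst.le⟩, rfl⟩)
    have hp : c • v + x t ∈ affineSpan ℝ (convexHull ℝ (x '' Icc a t)) :=
      AffineSubspace.smul_vsub_vadd_mem _ c hspan hsmem hspan
    have hpC : c • v + x t ∈ convexHull ℝ (x '' Icc a t) := by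
      refine hball (a := ⟨c • v + x t, hp⟩) ?_
      rw [mem_ball, Subtype.dist_eq, dist_eq_norm]
      simp only [add_sub_cancel_right]
      rw [norm_smul, Real.norm_eq_abs, abs_of_nonneg hc0, hcv]
      linarith
    have hle : ⟪v, c • v + x t⟫ ≤ ⟪v, x t⟫ + ‖v‖ * (ε / 4) := by
      refine se_hull_le ?_ _ hpC
      rintro _ ⟨r, ⟨hr1, hr2⟩, rfl⟩
      rcases le_or_gt r s with hrs | hrs
      · have := hk (x r) ⟨r, ⟨hr1, hrs⟩, rfl⟩
        have : 0 ≤ ‖v‖ * (ε / 4) := by positivity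
        nlinarith [sq_nonneg ‖v‖]
      · have h1 : dist (x r) (x t) < ε / 4 := by
          refine hcont ⟨hr1, hr2.trans htb⟩ ?_
          rw [Real.dist_eq, abs_lt]
          constructor <;> linarith
        rw [dist_eq_norm] at h1
        have h2 := real_inner_le_norm v (x r - x t)
        rw [inner_sub_right] at h2
        have h3 : ‖v‖ * ‖x r - x t‖ ≤ ‖v‖ * (ε / 4) := by gcongr
        linarith
    rw [inner_add_right, inner_smul_right, real_inner_self_eq_norm_sq] at hle
    have : c * ‖v‖ ^ 2 = ε / 2 * ‖v‖ := by rw [← hcv]; ring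
    nlinarith
  · intro t₁ t₂ h1 h2 h3 hmem
    obtain ⟨hpos, hk⟩ := key t₁ t₂ h1 h2 h3
    have := se_hull_le hk _ hmem
    nlinarith
  · intro t₁ t₂ h1 h2 h3
    obtain ⟨hpos, hk⟩ := key t₁ t₂ h1 h2 h3
    obtain ⟨m, rfl⟩ : ∃ m, n = m + 1 := ⟨n - 1, by omega⟩
    have hcomp : ∀ t, t ≤ b → IsCompact (x '' Icc a t) := fun t ht =>
      isCompact_Icc.image_of_continuousOn (hc.mono (Icc_subset_Icc_right ht))
    have hne : (x '' Icc a t₁).Nonempty := ⟨x t₁, t₁, ⟨h1, le_rfl⟩, rfl⟩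
    refine se_meanWidth_lt (v := ‖x t₂ - x t₁‖⁻¹ • (x t₂ - x t₁)) (hcomp t₁ (by linarith))
      (hcomp t₂ h3) hne (image_mono (Icc_subset_Icc_right h2.le)) ?_ ?_
    · rw [norm_smul, norm_inv, norm_norm, inv_mul_cancel₀ hpos.ne']
    · set v := x t₂ - x t₁ with hv
      have hup : suppFn (x '' Icc a t₁) (‖v‖⁻¹ • v) ≤ ‖v‖⁻¹ * (⟪v, x t₂⟫ - ‖v‖ ^ 2 / 2) := by
        refine csSup_le (hne.image _) ?_
        rintro _ ⟨y, hy, rfl⟩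
        simp only [real_inner_smul_left]
        exact mul_le_mul_of_nonneg_left (hk y hy) (by positivity)
      have hlow : ‖v‖⁻¹ * ⟪v, x t₂⟫ ≤ suppFn (x '' Icc a t₂) (‖v‖⁻¹ • v) := by
        refine le_csSup ((hcomp t₂ h3).image (by fun_prop)).bddAbove ?_
        exact ⟨x t₂, ⟨t₂, ⟨by linarith, le_rfl⟩, rfl⟩, real_inner_smul_left _ _ _⟩
      refine hup.trans_lt (lt_of_lt_of_le ?_ hlow)
      refine mul_lt_mul_of_pos_left ?_ (by positivity)
      have : 0 < ‖v‖ ^ 2 := by positivity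
      linarith

end
end

section
/- Let x : [a,b] → ℝⁿ (n ≥ 2) be a continuous injective self-expanding curve and let γ = x([a,b]). Then the map φ : [a,b] → ℝ defined by φ(t) = w(conv(x([a,t]))) is a continuous, strictly increasing bijection from [a,b] onto the interval [0, w(conv(γ))], and its inverse is continuous; consequently γ admits a continuous one-to-one parametrization by the mean width of the convex hulls of its initial arcs. -/
open Set Metric MeasureTheory
open scoped RealInnerProductSpace

noncomputable section

lemma aux_rot {n : ℕ} {p q : EuclideanSpace ℝ (Fin n)}
    (hp : p ∈ sphere (0 : EuclideanSpace ℝ (Fin n)) 1)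
    (hq : q ∈ sphere (0 : EuclideanSpace ℝ (Fin n)) 1) :
    ∃ e : EuclideanSpace ℝ (Fin n) ≃ᵢ EuclideanSpace ℝ (Fin n), e p = q ∧
      e ⁻¹' (sphere 0 1) = sphere 0 1 := by
  refine ⟨((ℝ ∙ (p - q))ᗮ.reflection).toIsometryEquiv, ?_, ?_⟩
  · exact Submodule.reflection_sub (by simp_all)
  · ext y
    simp

/-- Normalized chart of the sphere. -/
def auxChart (m : ℕ) (u : Fin m → ℝ) : EuclideanSpace ℝ (Fin (m + 1)) :=
  ‖(WithLp.toLp 2 (Fin.cons 1 u : Fin (m + 1) → ℝ) : EuclideanSpace ℝ (Fin (m + 1)))‖⁻¹ •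
    (WithLp.toLp 2 (Fin.cons 1 u : Fin (m + 1) → ℝ) : EuclideanSpace ℝ (Fin (m + 1)))

lemma auxChart_contDiff (m : ℕ) : ContDiff ℝ 1 (auxChart m) := by
  have h1 : ContDiff ℝ 1 (fun u : Fin m → ℝ =>
      (WithLp.toLp 2 (Fin.cons 1 u : Fin (m + 1) → ℝ) : EuclideanSpace ℝ (Fin (m + 1)))) := by
    rw [contDiff_euclidean]
    intro i
    refine Fin.cases ?_ (fun j => ?_) i
    · simpa using contDiff_const
    · simpa using contDiff_apply ℝ ℝ j
  have h2 : ∀ u : Fin m → ℝ,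
      (WithLp.toLp 2 (Fin.cons 1 u : Fin (m + 1) → ℝ) : EuclideanSpace ℝ (Fin (m + 1))) ≠ 0 := by
    intro u h
    have := congrArg (fun v : EuclideanSpace ℝ (Fin (m + 1)) => v 0) h
    simp at this
  exact ((h1.norm ℝ h2).inv (fun u => by simpa using h2 u)).smul h1

lemma auxChart_surj (m : ℕ) {θ : EuclideanSpace ℝ (Fin (m + 1))} (hθ : ‖θ‖ = 1) (h0 : 0 < θ 0) :
    auxChart m (fun j => (θ 0)⁻¹ * θ j.succ) = θ := by
  have : (WithLp.toLp 2 (Fin.cons 1 (fun j => (θ 0)⁻¹ * θ j.succ) : Fin (m + 1) → ℝ) :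
      EuclideanSpace ℝ (Fin (m + 1))) = (θ 0)⁻¹ • θ := by
    ext i
    refine Fin.cases ?_ (fun j => ?_) i
    · simp [h0.ne']
    · simp
  unfold auxChart
  rw [this, norm_smul, hθ, smul_smul, Real.norm_of_nonneg (by positivity)]
  simp [h0.ne']

lemma aux_e0_mem (m : ℕ) : (EuclideanSpace.single 0 1 : EuclideanSpace ℝ (Fin (m + 1))) ∈
    sphere (0 : EuclideanSpace ℝ (Fin (m + 1))) 1 := by simp

lemma aux_finite (m : ℕ) :
    (μH[(m : ℝ)] : Measure (EuclideanSpace ℝ (Fin (m + 1)))) (sphere 0 1) < ⊤ := by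
  obtain ⟨K, t, ht, hK⟩ := (auxChart_contDiff m).contDiffAt (x := 0).exists_lipschitzOnWith
  have hfin : (μH[(m : ℝ)] : Measure (EuclideanSpace ℝ (Fin (m + 1))))
      (auxChart m '' (t ∩ ball 0 1)) < ⊤ := by
    refine ((hK.mono inter_subset_left).hausdorffMeasure_image_le (by positivity)).trans_lt ?_
    have : (μH[(m : ℝ)] : Measure (Fin m → ℝ)) = volume := by
      simpa using hausdorffMeasure_pi_real (ι := Fin m)
    rw [this]
    refine ENNReal.mul_lt_top (by simp) ?_
    exact (measure_mono inter_subset_right).trans_lt measure_ball_lt_top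
  have hnear : ∀ᶠ θ in nhds (EuclideanSpace.single 0 1 : EuclideanSpace ℝ (Fin (m + 1))),
      ‖θ‖ = 1 → θ ∈ auxChart m '' (t ∩ ball 0 1) := by
    have hc0 : Continuous (fun θ : EuclideanSpace ℝ (Fin (m + 1)) => θ 0) := by fun_prop
    have h0 : ∀ᶠ θ in nhds (EuclideanSpace.single 0 1 : EuclideanSpace ℝ (Fin (m + 1))),
        0 < θ 0 := hc0.continuousAt.eventually_const_lt (by simp)
    have hc : ContinuousAt (fun θ : EuclideanSpace ℝ (Fin (m + 1)) =>
        (fun j : Fin m => (θ 0)⁻¹ * θ j.succ)) (EuclideanSpace.single 0 1) := by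
      refine continuousAt_pi.2 fun j => ?_
      refine (hc0.continuousAt.inv₀ (by simp)).mul ?_
      exact Continuous.continuousAt (by fun_prop)
    have hz : (fun j : Fin m => ((EuclideanSpace.single 0 1 : EuclideanSpace ℝ (Fin (m + 1))) 0)⁻¹ *
      (EuclideanSpace.single 0 1 : EuclideanSpace ℝ (Fin (m + 1))) j.succ) = 0 := by
      ext j; simp
    have hm : ∀ᶠ θ in nhds (EuclideanSpace.single 0 1 : EuclideanSpace ℝ (Fin (m + 1))),
        (fun j : Fin m => (θ 0)⁻¹ * θ j.succ) ∈ t ∩ ball 0 1 := by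
      apply hc
      beta_reduce
      rw [hz]
      exact Filter.inter_mem ht (ball_mem_nhds _ one_pos)
    filter_upwards [h0, hm] with θ h1 h2 h3
    exact ⟨_, h2, auxChart_surj m h3 h1⟩
  refine (isCompact_sphere _ _).measure_lt_top_of_nhdsWithin fun p hp => ?_
  obtain ⟨e, he, hes⟩ := aux_rot hp (aux_e0_mem m)
  refine ⟨e ⁻¹' (auxChart m '' (t ∩ ball 0 1)), ?_, ?_⟩
  · rw [← he] at hnear
    filter_upwards [nhdsWithin_le_nhds (e.continuous.continuousAt.eventually hnear),
      self_mem_nhdsWithin] with y h1 h2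
    rw [← hes] at h2
    exact h1 (mem_sphere_zero_iff_norm.1 h2)
  · rwa [e.hausdorffMeasure_preimage]

lemma aux_pos (m : ℕ) :
    (μH[(m : ℝ)] : Measure (EuclideanSpace ℝ (Fin (m + 1)))) (sphere 0 1) ≠ 0 := by
  intro h0
  have hL : LipschitzWith 1 (fun θ : EuclideanSpace ℝ (Fin (m + 1)) => fun j : Fin m => θ j.succ) := by
    refine LipschitzWith.of_dist_le_mul fun y z => ?_
    rw [NNReal.coe_one, one_mul]
    refine (dist_pi_le_iff dist_nonneg).2 fun j => ?_
    have := (PiLp.lipschitzWith_ofLp 2 (fun _ : Fin (m + 1) => ℝ)).dist_le_mul y z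
    simp only [NNReal.coe_one, one_mul] at this
    exact (dist_le_pi_dist _ _ j.succ).trans this
  have h1 := hL.hausdorffMeasure_image_le (d := (m : ℝ)) (by positivity) (sphere 0 1)
  have : (μH[(m : ℝ)] : Measure (Fin m → ℝ)) = volume := by
    simpa using hausdorffMeasure_pi_real (ι := Fin m)
  rw [h0, this, mul_zero] at h1
  have ho : IsOpen {u : Fin m → ℝ | ∑ j, u j ^ 2 < 1} :=
    isOpen_lt (by fun_prop) continuous_const
  have hp := ho.measure_pos volume ⟨0, by simp⟩
  refine hp.ne' (le_antisymm ((measure_mono ?_).trans h1) bot_le)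
  intro u hu
  simp only [mem_ofPred_eq] at hu
  refine ⟨WithLp.toLp 2 (Fin.cons (Real.sqrt (1 - ∑ j, u j ^ 2)) u : Fin (m + 1) → ℝ), ?_, ?_⟩
  · simp [EuclideanSpace.norm_eq, Fin.sum_univ_succ]
    rw [Real.sq_sqrt (by linarith)]
    simp
  · ext j; simp

lemma aux_open_pos (m : ℕ) {U : Set (EuclideanSpace ℝ (Fin (m + 1)))} (hU : IsOpen U)
    (hne : (U ∩ sphere 0 1).Nonempty) :
    (μH[(m : ℝ)] : Measure (EuclideanSpace ℝ (Fin (m + 1)))) (U ∩ sphere 0 1) ≠ 0 := by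
  intro h0
  obtain ⟨q, hqU, hq⟩ := hne
  refine aux_pos m (measure_null_of_locally_null _ fun p hp => ?_)
  obtain ⟨e, he, hes⟩ := aux_rot hp hq
  refine ⟨e ⁻¹' (U ∩ sphere 0 1), ?_, ?_⟩
  · rw [preimage_inter, hes]
    exact Filter.inter_mem (nhdsWithin_le_nhds ((hU.preimage e.continuous).mem_nhds
      (by rw [mem_preimage, he]; exact hqU))) self_mem_nhdsWithin
  · rwa [e.hausdorffMeasure_preimage]

lemma aux_supp_le {n : ℕ} {S : Set (EuclideanSpace ℝ (Fin n))} (hne : S.Nonempty)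
    {θ : EuclideanSpace ℝ (Fin n)} {c : ℝ} (h : ∀ y ∈ S, ⟪θ, y⟫ ≤ c) :
    suppFn (convexHull ℝ S) θ ≤ c := by
  refine csSup_le (hne.convexHull.image _) ?_
  rintro _ ⟨y, hy, rfl⟩
  have hconv : Convex ℝ {y : EuclideanSpace ℝ (Fin n) | ⟪θ, y⟫ ≤ c} :=
    convex_halfSpace_le (innerSL ℝ θ).isLinear c
  exact convexHull_min (fun z hz => h z hz) hconv hy

lemma aux_le_supp {n : ℕ} {S : Set (EuclideanSpace ℝ (Fin n))} (hS : IsCompact S)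
    (θ : EuclideanSpace ℝ (Fin n)) {y : EuclideanSpace ℝ (Fin n)} (hy : y ∈ S) :
    ⟪θ, y⟫ ≤ suppFn (convexHull ℝ S) θ := by
  refine le_csSup ?_ ⟨y, subset_convexHull ℝ S hy, rfl⟩
  obtain ⟨c, hc⟩ := (hS.image (f := fun y => ⟪θ, y⟫) (by fun_prop)).bddAbove
  refine ⟨c, ?_⟩
  rintro _ ⟨z, hz, rfl⟩
  have hconv : Convex ℝ {y : EuclideanSpace ℝ (Fin n) | ⟪θ, y⟫ ≤ c} :=
    convex_halfSpace_le (innerSL ℝ θ).isLinear c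
  exact convexHull_min (fun w hw => hc ⟨w, hw, rfl⟩) hconv hz

lemma aux_supp_cont {n : ℕ} {S : Set (EuclideanSpace ℝ (Fin n))} (hS : IsCompact S)
    (hne : S.Nonempty) : Continuous (suppFn (convexHull ℝ S)) := by
  obtain ⟨R, hR⟩ := hS.isBounded.exists_norm_le
  have hR0 : 0 ≤ R := (norm_nonneg _).trans (hR _ hne.some_mem)
  refine LipschitzWith.continuous (K := ⟨R, hR0⟩) (LipschitzWith.of_le_add_mul _ fun θ η => ?_)
  refine aux_supp_le hne fun y hy => ?_
  have h1 := aux_le_supp hS η hy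
  have h2 : ⟪θ - η, y⟫ ≤ ‖θ - η‖ * ‖y‖ := real_inner_le_norm _ _
  have h3 : ‖θ - η‖ * ‖y‖ ≤ ‖θ - η‖ * R := by gcongr; exact hR y hy
  rw [inner_sub_left] at h2
  rw [dist_eq_norm]
  change _ ≤ _ + R * _
  linarith

lemma aux_sphereMeasure (m : ℕ) : sphereMeasure (m + 1) = μH[(m : ℝ)] := by
  simp [sphereMeasure]

lemma aux_integrable (m : ℕ) {f : EuclideanSpace ℝ (Fin (m + 1)) → ℝ} (hf : Continuous f) :
    IntegrableOn f (sphere 0 1) (sphereMeasure (m + 1)) := by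
  have hfin := aux_finite m
  rw [← aux_sphereMeasure] at hfin
  obtain ⟨C, hC⟩ := (isCompact_sphere (0 : EuclideanSpace ℝ (Fin (m + 1))) 1).exists_bound_of_continuousOn
    hf.continuousOn
  exact IntegrableOn.of_bound hfin hf.aestronglyMeasurable.restrict C
    (ae_restrict_of_forall_mem isClosed_sphere.measurableSet hC)

lemma aux_area_pos (m : ℕ) : 0 < sphereArea (m + 1) := by
  unfold sphereArea
  rw [aux_sphereMeasure]
  exact ENNReal.toReal_pos (aux_pos m) (aux_finite m).ne

lemma aux_mw_singleton (m : ℕ) (p : EuclideanSpace ℝ (Fin (m + 1))) :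
    meanWidth (convexHull ℝ {p}) = 0 := by
  unfold meanWidth
  have h : ∀ θ, suppFn (convexHull ℝ {p}) θ = ⟪θ, p⟫ := by
    intro θ; simp [suppFn]
  simp only [h]
  have hmp := (IsometryEquiv.neg (EuclideanSpace ℝ (Fin (m + 1)))).measurePreserving_hausdorffMeasure
    (m : ℝ)
  have := hmp.setIntegral_preimage_emb
    (IsometryEquiv.neg (EuclideanSpace ℝ (Fin (m + 1)))).toHomeomorph.measurableEmbedding
    (fun θ => ⟪θ, p⟫) (sphere 0 1)
  have hs : (IsometryEquiv.neg (EuclideanSpace ℝ (Fin (m + 1)))) ⁻¹' (sphere 0 1) = sphere 0 1 := by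
    ext y; simp
  rw [hs] at this
  simp only [IsometryEquiv.neg_apply, inner_neg_left, integral_neg] at this
  rw [aux_sphereMeasure]
  have h0 : ∫ θ in sphere (0 : EuclideanSpace ℝ (Fin (m + 1))) 1, ⟪θ, p⟫ ∂μH[(m : ℝ)] = 0 := by
    linarith
  rw [h0, mul_zero]

lemma aux_mw_lt (m : ℕ) {S T : Set (EuclideanSpace ℝ (Fin (m + 1)))} (hS : IsCompact S)
    (hSne : S.Nonempty) (hT : IsCompact T) (hST : S ⊆ T) {v : EuclideanSpace ℝ (Fin (m + 1))}
    {c : ℝ} {p : EuclideanSpace ℝ (Fin (m + 1))} (hp : p ∈ T)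
    (hv : v ≠ 0) (h1 : ∀ y ∈ S, ⟪v, y⟫ ≤ c) (h2 : c < ⟪v, p⟫) :
    meanWidth (convexHull ℝ S) < meanWidth (convexHull ℝ T) := by
  have hcS := aux_supp_cont hS hSne
  have hcT := aux_supp_cont hT (hSne.mono hST)
  unfold meanWidth
  refine mul_lt_mul_of_pos_left ?_ (div_pos two_pos (aux_area_pos m))
  rw [← sub_pos, ← integral_sub (aux_integrable m hcT) (aux_integrable m hcS)]
  refine (setIntegral_pos_iff_support_of_nonneg_ae ?_
    (aux_integrable m (hcT.sub hcS))).2 ?_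
  rotate_left
  · rw [aux_sphereMeasure, pos_iff_ne_zero]
    refine aux_open_pos m ((hcT.sub hcS).isOpen_support) ⟨‖v‖⁻¹ • v, ?_, ?_⟩
    · have hv' : 0 < ‖v‖⁻¹ := inv_pos.2 (norm_pos_iff.2 hv)
      have e1 : suppFn (convexHull ℝ S) (‖v‖⁻¹ • v) ≤ ‖v‖⁻¹ * c := by
        refine aux_supp_le hSne fun y hy => ?_
        rw [real_inner_smul_left]
        exact mul_le_mul_of_nonneg_left (h1 y hy) hv'.le
      have e2 := aux_le_supp hT (‖v‖⁻¹ • v) hp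
      rw [real_inner_smul_left] at e2
      have e3 := mul_lt_mul_of_pos_left h2 hv'
      rw [Function.mem_support]
      exact (sub_pos.2 (by linarith)).ne'
    · simp [norm_smul, hv]
  · refine Filter.Eventually.of_forall fun θ => ?_
    simp only [Pi.zero_apply, Pi.sub_apply, sub_nonneg]
    exact aux_supp_le hSne fun y hy => aux_le_supp hT θ (hST hy)

lemma aux_mw_close (m : ℕ) {S T : Set (EuclideanSpace ℝ (Fin (m + 1)))} (hS : IsCompact S)
    (hSne : S.Nonempty) (hT : IsCompact T) (hST : S ⊆ T) {ε : ℝ}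
    (h : ∀ y ∈ T, ∃ z ∈ S, dist y z ≤ ε) :
    |meanWidth (convexHull ℝ T) - meanWidth (convexHull ℝ S)| ≤ 2 * ε := by
  have hcS := aux_supp_cont hS hSne
  have hcT := aux_supp_cont hT (hSne.mono hST)
  have hA := aux_area_pos m
  have hfin := aux_finite m
  rw [← aux_sphereMeasure] at hfin
  unfold meanWidth
  rw [← mul_sub, ← integral_sub (aux_integrable m hcT) (aux_integrable m hcS), abs_mul,
    abs_of_pos (div_pos two_pos hA)]
  have key : ‖∫ θ in sphere (0 : EuclideanSpace ℝ (Fin (m + 1))) 1,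
      (suppFn (convexHull ℝ T) θ - suppFn (convexHull ℝ S) θ) ∂(sphereMeasure (m + 1))‖ ≤
      ε * sphereArea (m + 1) := by
    refine norm_setIntegral_le_of_norm_le_const hfin fun θ hθ => ?_
    have hle : suppFn (convexHull ℝ S) θ ≤ suppFn (convexHull ℝ T) θ :=
      aux_supp_le hSne fun y hy => aux_le_supp hT θ (hST hy)
    rw [Real.norm_of_nonneg (sub_nonneg.2 hle), sub_le_iff_le_add]
    refine aux_supp_le (hSne.mono hST) fun y hy => ?_
    obtain ⟨z, hz, hyz⟩ := h y hy
    have e1 := aux_le_supp hS θ hz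
    have e2 : ⟪θ, y - z⟫ ≤ ‖θ‖ * ‖y - z‖ := real_inner_le_norm _ _
    rw [mem_sphere_zero_iff_norm.1 hθ, one_mul, inner_sub_right, ← dist_eq_norm] at e2
    linarith
  rw [Real.norm_eq_abs] at key
  calc _ ≤ 2 / sphereArea (m + 1) * (ε * sphereArea (m + 1)) := by gcongr
    _ = 2 * ε := by field_simp

/-- the mean width reparametrization of a self expanding curve. -/
theorem selfExpanding_meanWidth_parametrization {n : ℕ} (hn : 2 ≤ n) {a b : ℝ} (hab : a ≤ b)
    {x : ℝ → EuclideanSpace ℝ (Fin n)}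
    (hx : SelfExpanding a b x) (hinj : Set.InjOn x (Icc a b)) :
    ContinuousOn (fun t => meanWidth (convexHull ℝ (x '' Icc a t))) (Icc a b) ∧
    StrictMonoOn (fun t => meanWidth (convexHull ℝ (x '' Icc a t))) (Icc a b) ∧
    (fun t => meanWidth (convexHull ℝ (x '' Icc a t))) '' Icc a b =
      Icc 0 (meanWidth (convexHull ℝ (x '' Icc a b))) ∧
    ∃ ψ : ℝ → ℝ,
      ContinuousOn ψ (Icc 0 (meanWidth (convexHull ℝ (x '' Icc a b)))) ∧
      (∀ t ∈ Icc a b, ψ (meanWidth (convexHull ℝ (x '' Icc a t))) = t) ∧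
      (∀ s ∈ Icc 0 (meanWidth (convexHull ℝ (x '' Icc a b))),
        meanWidth (convexHull ℝ (x '' Icc a (ψ s))) = s) ∧
      ContinuousOn (x ∘ ψ) (Icc 0 (meanWidth (convexHull ℝ (x '' Icc a b)))) ∧
      Set.InjOn (x ∘ ψ) (Icc 0 (meanWidth (convexHull ℝ (x '' Icc a b)))) ∧
      (x ∘ ψ) '' Icc 0 (meanWidth (convexHull ℝ (x '' Icc a b))) = x '' Icc a b := by
  obtain ⟨m, rfl⟩ : ∃ m, n = m + 1 := ⟨n - 1, by omega⟩
  obtain ⟨hc, hexp⟩ := hx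
  have hcomp : ∀ t ∈ Icc a b, IsCompact (x '' Icc a t) := fun t ht =>
    isCompact_Icc.image_of_continuousOn (hc.mono (Icc_subset_Icc_right ht.2))
  have hne : ∀ t ∈ Icc a b, (x '' Icc a t).Nonempty := fun t ht =>
    ⟨x a, a, ⟨le_rfl, ht.1⟩, rfl⟩
  have hsub : ∀ s t, s ≤ t → x '' Icc a s ⊆ x '' Icc a t := fun s t h =>
    image_mono (Icc_subset_Icc_right h)
  set φ : ℝ → ℝ := fun t => meanWidth (convexHull ℝ (x '' Icc a t)) with hφ
  have hmono : StrictMonoOn φ (Icc a b) := by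
    intro s hs t ht hst
    have hxne : x t - x s ≠ 0 := by
      rw [sub_ne_zero]
      exact fun h => hst.ne' (hinj ht hs h)
    refine aux_mw_lt m (hcomp s hs) (hne s hs) (hcomp t ht) (hsub s t hst.le)
      (v := x t - x s) (c := (‖x t‖ ^ 2 - ‖x s‖ ^ 2) / 2) (p := x t)
      ⟨t, ⟨ht.1, le_rfl⟩, rfl⟩ hxne ?_ ?_
    · rintro _ ⟨r, hr, rfl⟩
      have h := hexp r s t hr.1 hr.2 hst.le ht.2
      rw [dist_eq_norm, dist_eq_norm] at h
      have h2 := pow_le_pow_left₀ (norm_nonneg _) h 2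
      rw [norm_sub_sq_real, norm_sub_sq_real] at h2
      rw [inner_sub_left]
      linarith
    · have h : 0 < ‖x t - x s‖ ^ 2 := by positivity
      rw [norm_sub_sq_real] at h
      rw [inner_sub_left, real_inner_self_eq_norm_sq, real_inner_comm]
      linarith
  have hcont : ContinuousOn φ (Icc a b) := by
    have huc := isCompact_Icc.uniformContinuousOn_of_continuous hc
    rw [Metric.uniformContinuousOn_iff] at huc
    rw [Metric.continuousOn_iff]
    have key : ∀ ε > 0, ∃ δ > 0, ∀ s ∈ Icc a b, ∀ t ∈ Icc a b, s ≤ t → t - s < δ →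
        |φ t - φ s| ≤ 2 * ε := by
      intro ε hε
      obtain ⟨δ, hδ, h⟩ := huc ε hε
      refine ⟨δ, hδ, fun s hs t ht hst hd => ?_⟩
      refine aux_mw_close m (hcomp s hs) (hne s hs) (hcomp t ht) (hsub s t hst) ?_
      rintro _ ⟨r, hr, rfl⟩
      rcases le_total r s with hrs | hrs
      · exact ⟨x r, ⟨r, ⟨hr.1, hrs⟩, rfl⟩, by simpa using hε.le⟩
      · refine ⟨x s, ⟨s, ⟨hs.1, le_rfl⟩, rfl⟩, (h r ⟨hr.1, hr.2.trans ht.2⟩ s hs ?_).le⟩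
        rw [Real.dist_eq, abs_of_nonneg (sub_nonneg.2 hrs)]
        linarith [hr.2]
    intro t ht ε hε
    obtain ⟨δ, hδ, h⟩ := key (ε / 4) (by positivity)
    refine ⟨δ, hδ, fun s hs hd => ?_⟩
    rw [Real.dist_eq] at hd ⊢
    rcases le_total s t with hst | hst
    · have := h s hs t ht hst (by rw [abs_sub_comm] at hd; exact (le_abs_self _).trans_lt hd)
      rw [abs_sub_comm]
      linarith
    · have := h t ht s hs hst ((le_abs_self _).trans_lt hd)
      linarith
  have ha0 : φ a = 0 := by
    simp only [hφ, Icc_self, image_singleton]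
    exact aux_mw_singleton m _
  have haI : a ∈ Icc a b := ⟨le_rfl, hab⟩
  have hbI : b ∈ Icc a b := ⟨hab, le_rfl⟩
  have himg : φ '' Icc a b = Icc 0 (φ b) := by
    apply Subset.antisymm
    · rintro _ ⟨t, ht, rfl⟩
      exact ⟨ha0 ▸ hmono.monotoneOn haI ht ht.1, hmono.monotoneOn ht hbI ht.2⟩
    · rw [← ha0]
      exact intermediate_value_Icc hab hcont
  change ContinuousOn φ (Icc a b) ∧ StrictMonoOn φ (Icc a b) ∧ φ '' Icc a b = Icc 0 (φ b) ∧
    ∃ ψ : ℝ → ℝ, ContinuousOn ψ (Icc 0 (φ b)) ∧ (∀ t ∈ Icc a b, ψ (φ t) = t) ∧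
      (∀ s ∈ Icc 0 (φ b), φ (ψ s) = s) ∧ ContinuousOn (x ∘ ψ) (Icc 0 (φ b)) ∧
      Set.InjOn (x ∘ ψ) (Icc 0 (φ b)) ∧ (x ∘ ψ) '' Icc 0 (φ b) = x '' Icc a b
  refine ⟨hcont, hmono, himg, Function.invFunOn φ (Icc a b), ?_⟩
  set ψ := Function.invFunOn φ (Icc a b)
  have hl : ∀ t ∈ Icc a b, ψ (φ t) = t := fun t ht => hmono.injOn.leftInvOn_invFunOn ht
  have hr : ∀ s ∈ Icc 0 (φ b), φ (ψ s) = s := fun s hs =>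
    Function.invFunOn_eq (by rw [← himg] at hs; exact hs)
  have hmaps : MapsTo ψ (Icc 0 (φ b)) (Icc a b) := fun s hs =>
    Function.invFunOn_mem (by rw [← himg] at hs; exact hs)
  have hψc : ContinuousOn ψ (Icc 0 (φ b)) := by
    rw [continuousOn_iff_isClosed]
    intro C hC
    refine ⟨φ '' (Icc a b ∩ C), ((isCompact_Icc.inter_right hC).image_of_continuousOn
      (hcont.mono inter_subset_left)).isClosed, ?_⟩
    ext s
    constructor
    · rintro ⟨h1, h2⟩
      exact ⟨⟨ψ s, ⟨hmaps h2, h1⟩, hr s h2⟩, h2⟩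
    · rintro ⟨⟨t, ⟨ht, htC⟩, rfl⟩, h2⟩
      refine ⟨?_, h2⟩
      rw [mem_preimage, hl t ht]
      exact htC
  refine ⟨hψc, hl, hr, hc.comp hψc hmaps, ?_, ?_⟩
  · intro s hs t ht hst
    have := hinj (hmaps hs) (hmaps ht) hst
    rw [← hr s hs, ← hr t ht, this]
  · rw [image_comp]
    congr 1
    apply Subset.antisymm hmaps.image_subset
    intro t ht
    exact ⟨φ t, himg ▸ mem_image_of_mem φ ht, hl t ht⟩

end
end

section
/- Let x : [a,b] → ℝⁿ be a self-expanding curve. Then: (1) for all a ≤ t' ≤ t'' ≤ t ≤ b, |x(t'') − x(t')| ≤ |x(t) − x(t')|; and (2) at every t ∈ (a,b) where the derivative ẋ(t) exists, ẋ(t) belongs to the normal cone of conv(x([a,t])) at x(t), i.e. ⟨ẋ(t), y − x(t)⟩ ≤ 0 for every y ∈ conv(x([a,t])). -/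
open Set Metric MeasureTheory
open scoped RealInnerProductSpace

noncomputable section

/-- monotonicity and the differential inclusion for self expanding curves. -/
theorem selfExpanding_monotone_and_deriv_mem_normalCone {n : ℕ} {a b : ℝ}
    {x : ℝ → EuclideanSpace ℝ (Fin n)} (hx : SelfExpanding a b x) :
    (∀ t' t'' t, a ≤ t' → t' ≤ t'' → t'' ≤ t → t ≤ b →
      dist (x t'') (x t') ≤ dist (x t) (x t')) ∧
    (∀ t ∈ Ioo a b, ∀ v : EuclideanSpace ℝ (Fin n), HasDerivAt x v t →
      v ∈ normalCone (convexHull ℝ (x '' Icc a t)) (x t)) := by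
  refine ⟨hx.2, ?_⟩
  intro t ht v hv y hy
  have hconv : Convex ℝ {y : EuclideanSpace ℝ (Fin n) | ⟪v, y⟫ ≤ ⟪v, x t⟫} :=
    convex_halfSpace_le (innerSL ℝ v).toLinearMap.isLinear _
  have hsub : x '' Icc a t ⊆ {y : EuclideanSpace ℝ (Fin n) | ⟪v, y⟫ ≤ ⟪v, x t⟫} := by
    rintro _ ⟨s, hs, rfl⟩
    have h1 : HasDerivAt (fun u => ‖x u - x s‖ ^ 2) (2 * ⟪x t - x s, v⟫) t :=
      (hv.sub_const (x s)).norm_sq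
    have h2 := (hasDerivWithinAt_iff_tendsto_slope' (s := Ioi t) (by simp)).1 h1.hasDerivWithinAt
    have h3 : 0 ≤ 2 * ⟪x t - x s, v⟫ := by
      refine ge_of_tendsto h2 ?_
      filter_upwards [Ioo_mem_nhdsGT ht.2] with u hu
      rw [slope_def_field]
      have h4 := hx.2 s t u hs.1 hs.2 hu.1.le hu.2.le
      rw [dist_eq_norm, dist_eq_norm] at h4
      apply div_nonneg
      · rw [sub_nonneg]
        gcongr
      · linarith [hu.1]
    rw [inner_sub_left, real_inner_comm v (x t), real_inner_comm v (x s)] at h3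
    show ⟪v, x s⟫ ≤ ⟪v, x t⟫
    linarith
  have h := convexHull_min hsub hconv hy
  rw [inner_sub_right]
  exact sub_nonpos.2 h

end
end
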